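/- Let n ≥ 5 and let N be a group of order n!. Suppose there exist a group homomorphism f : Sₙ → Aut(N) and a bijective map g : Sₙ → N satisfying g(στ) = g(σ) · f(σ)(g(τ)) for all σ, τ ∈ Sₙ. Then N is not perfect, i.e., N ≠ [N, N]. -/

import Mathlib

lemma kaz_avg (s : Multiset ℂ) (e : ℕ) (he : e ≠ 0) (hs : ∀ z ∈ s, z ^ e = 1) (hs0 : s ≠ 0)
    (x : ℂ) (hx : x * (Multiset.card s : ℂ) = s.sum) (hint : IsIntegral ℤ x) (hx0 : x ≠ 0) :
    ∀ z ∈ s, z = x := by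
  classical
  have hc0 : (Multiset.card s : ℂ) ≠ 0 := by
    simpa using hs0
  have hxe : x = s.sum / (Multiset.card s : ℂ) := by field_simp; exact hx
  let K := IntermediateField.adjoin ℚ {z : ℂ | z ∈ s}
  have hfin : FiniteDimensional ℚ K := by
    have : Finite {z : ℂ | z ∈ s} := by
      have : {z : ℂ | z ∈ s} = (s.toFinset : Set ℂ) := by ext; simp
      rw [this]; infer_instance
    apply IntermediateField.finiteDimensional_adjoin
    intro z hz
    refine IsIntegral.of_pow (n := e) (Nat.pos_of_ne_zero he) ?_
    rw [hs z hz]; exact isIntegral_one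
  have : NumberField K := ⟨⟩
  have hmem : ∀ z ∈ s, z ∈ K := fun z hz => IntermediateField.subset_adjoin ℚ _ hz
  obtain ⟨s', hs'⟩ : ∃ s' : Multiset K, s'.map (algebraMap K ℂ) = s := by
    refine ⟨s.attach.map (fun z => ⟨z.1, hmem z.1 z.2⟩), ?_⟩
    rw [Multiset.map_map]
    conv_rhs => rw [← Multiset.attach_map_val s]
    rfl
  let x' : K := s'.sum / (Multiset.card s' : K)
  have hcard : Multiset.card s' = Multiset.card s := by rw [← hs', Multiset.card_map]
  have hx' : algebraMap K ℂ x' = x := by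
    rw [hxe]
    simp only [x']
    rw [map_div₀, map_multiset_sum, hs', map_natCast, hcard]
  have hroot : ∀ z ∈ s', z ^ e = 1 := by
    intro z hz
    apply (algebraMap K ℂ).injective
    rw [map_pow, map_one]
    exact hs _ (by rw [← hs']; exact Multiset.mem_map_of_mem _ hz)
  obtain ⟨k, hk, hk1⟩ := NumberField.Embeddings.pow_eq_one_of_norm_le_one K ℂ (x := x')
    (by rintro h; apply hx0; rw [← hx', h, map_zero])
    (by
      have : IsIntegral ℤ (algebraMap K ℂ x') := by rw [hx']; exact hint
      exact (isIntegral_algebraMap_iff (algebraMap K ℂ).injective).1 this)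
    (by
      intro φ
      simp only [x']
      rw [map_div₀, map_multiset_sum, map_natCast, norm_div]
      apply div_le_one_of_le₀ _ (norm_nonneg _)
      refine (norm_multiset_sum_le _).trans ?_
      rw [Multiset.map_map]
      have : ∀ z ∈ s', (Norm.norm ∘ φ) z = 1 := by
        intro z hz
        have : (φ z) ^ e = 1 := by rw [← map_pow, hroot z hz, map_one]
        exact Complex.norm_eq_one_of_pow_eq_one this he
      rw [Multiset.map_congr rfl this]
      simp)
  have hnx : ‖x‖ = 1 := by
    apply Complex.norm_eq_one_of_pow_eq_one (n := k) _ hk.ne'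
    rw [← hx', ← map_pow, hk1, map_one]
  have hxc : x * (starRingEnd ℂ) x = 1 := by
    rw [Complex.mul_conj, Complex.normSq_eq_norm_sq, hnx]; simp
  have hre : ∀ z ∈ s, (1 - (z * (starRingEnd ℂ) x).re) ≥ 0 := by
    intro z hz
    have h1 : ‖z‖ = 1 := Complex.norm_eq_one_of_pow_eq_one (hs z hz) he
    have := Complex.re_le_norm (z * (starRingEnd ℂ) x)
    rw [norm_mul, Complex.norm_conj, h1, hnx] at this
    linarith
  have hsum0 : (s.map (fun z => 1 - (z * (starRingEnd ℂ) x).re)).sum = 0 := by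
    rw [Multiset.sum_map_sub]
    have h2 : (s.map (fun z => (z * (starRingEnd ℂ) x).re)).sum = ((s.map (fun z => z * (starRingEnd ℂ) x)).sum).re := by
      have := map_multiset_sum Complex.reAddGroupHom (s.map (fun z => z * (starRingEnd ℂ) x))
      rw [Multiset.map_map] at this
      exact this.symm
    rw [h2, Multiset.sum_map_mul_right, Multiset.map_id', ← hx, mul_right_comm, hxc]
    simp
  intro z hz
  have hz0 : 1 - (z * (starRingEnd ℂ) x).re = 0 := by
    have := Multiset.single_le_sum (s := s.map (fun z => 1 - (z * (starRingEnd ℂ) x).re))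
      (by intro y hy; obtain ⟨w, hw, rfl⟩ := Multiset.mem_map.1 hy; exact hre w hw) _
      (Multiset.mem_map_of_mem _ hz)
    rw [hsum0] at this
    linarith [hre z hz]
  have h1 : ‖z * (starRingEnd ℂ) x‖ = 1 := by
    rw [norm_mul, Complex.norm_conj, Complex.norm_eq_one_of_pow_eq_one (hs z hz) he, hnx, mul_one]
  have h3 : z * (starRingEnd ℂ) x = 1 := by
    have h4 := Complex.sq_norm (z * (starRingEnd ℂ) x)
    rw [h1, Complex.normSq_apply] at h4
    have h5 : (z * (starRingEnd ℂ) x).re = 1 := by linarith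
    rw [h5] at h4
    have h6 : (z * (starRingEnd ℂ) x).im = 0 := by nlinarith
    apply Complex.ext
    · rw [h5]; simp
    · rw [h6]; simp
  calc z = z * (x * (starRingEnd ℂ) x) := by rw [hxc, mul_one]
    _ = (z * (starRingEnd ℂ) x) * x := by ring
    _ = x := by rw [h3, one_mul]

open Module in
lemma kaz_scalar {V : Type*} [AddCommGroup V] [Module ℂ V] [FiniteDimensional ℂ V]
    (D : Module.End ℂ V) (e : ℕ) (he : e ≠ 0) (hD : D ^ e = 1) (hV : finrank ℂ V ≠ 0)
    (x : ℂ) (hx : x * (finrank ℂ V : ℂ) = LinearMap.trace ℂ V D) (hint : IsIntegral ℤ x)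
    (hx0 : x ≠ 0) : D = algebraMap ℂ _ x := by
  have hsplit : D.charpoly.Splits := IsAlgClosed.splits _
  have hroot : ∀ z ∈ D.charpoly.roots, z ^ e = 1 := by
    intro z hz
    have hz1 : D.HasEigenvalue z := by
      rw [Module.End.hasEigenvalue_iff_isRoot_charpoly]
      exact (Polynomial.mem_roots'.1 hz).2
    obtain ⟨v, hv⟩ := hz1.exists_hasEigenvector
    have := hv.pow_apply e
    rw [hD] at this
    have hv0 := hv.2
    have h2 : (z ^ e - 1) • v = 0 := by
      rw [sub_smul, ← this]; simp
    rcases smul_eq_zero.1 h2 with h | h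
    · exact sub_eq_zero.1 h
    · exact absurd h hv0
  have hcard : Multiset.card D.charpoly.roots = finrank ℂ V := by
    rw [← hsplit.natDegree_eq_card_roots, LinearMap.charpoly_natDegree]
  have htr : LinearMap.trace ℂ V D = D.charpoly.roots.sum :=
    Module.End.trace_eq_sum_roots_charpoly_of_splits hsplit
  have hall := kaz_avg D.charpoly.roots e he hroot
    (by intro h; rw [h] at hcard; exact hV hcard.symm) x (by rw [hcard, hx, htr]) hint hx0
  have hrep : D.charpoly.roots = Multiset.replicate (finrank ℂ V) x := by
    rw [Multiset.eq_replicate]; exact ⟨hcard, hall⟩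
  have hch : D.charpoly = (Polynomial.X - Polynomial.C x) ^ (finrank ℂ V) := by
    rw [hsplit.eq_prod_roots_of_monic (LinearMap.charpoly_monic D), hrep]
    simp
  have hnil : IsNilpotent (D - algebraMap ℂ _ x) := by
    refine ⟨finrank ℂ V, ?_⟩
    have := LinearMap.aeval_self_charpoly D
    rw [hch] at this
    simpa using this
  have hss : D.IsSemisimple := by
    apply Module.End.isSemisimple_of_squarefree_aeval_eq_zero (p := Polynomial.X ^ e - Polynomial.C 1)
    · exact (Polynomial.separable_X_pow_sub_C (1:ℂ) (by exact_mod_cast he) one_ne_zero).squarefree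
    · simp [hD]
  have hss2 : (D - algebraMap ℂ _ x).IsSemisimple := by
    have : (algebraMap ℂ (Module.End ℂ V) x).IsSemisimple := by
      apply Module.End.isSemisimple_of_squarefree_aeval_eq_zero (p := Polynomial.X - Polynomial.C x)
      · exact (Polynomial.separable_X_sub_C).squarefree
      · simp
    exact Module.End.IsSemisimple.sub_of_commute (Algebra.commutes x D).symm hss this
  have := Module.End.eq_zero_of_isNilpotent_isSemisimple hnil hss2
  exact sub_eq_zero.1 this


open Module in
lemma kaz_trace_int {V : Type*} [AddCommGroup V] [Module ℂ V] [FiniteDimensional ℂ V]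
    (D : Module.End ℂ V) (e : ℕ) (he : e ≠ 0) (hD : D ^ e = 1) :
    IsIntegral ℤ (LinearMap.trace ℂ V D) := by
  have hsplit : D.charpoly.Splits := IsAlgClosed.splits _
  rw [Module.End.trace_eq_sum_roots_charpoly_of_splits hsplit]
  apply IsIntegral.multiset_sum
  intro z hz
  have hz1 : D.HasEigenvalue z := by
    rw [Module.End.hasEigenvalue_iff_isRoot_charpoly]
    exact (Polynomial.mem_roots'.1 hz).2
  obtain ⟨v, hv⟩ := hz1.exists_hasEigenvector
  have := hv.pow_apply e
  rw [hD] at this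
  have hv0 := hv.2
  have h2 : (z ^ e - 1) • v = 0 := by
    rw [sub_smul, ← this]; simp
  refine IsIntegral.of_pow (n := e) (Nat.pos_of_ne_zero he) ?_
  rcases smul_eq_zero.1 h2 with h | h
  · rw [sub_eq_zero.1 h]; exact isIntegral_one
  · exact absurd h hv0

open Module in
lemma kaz_rep {G : Type*} [Group G] [Finite G] {W : Type*} [AddCommGroup W] [Module ℂ W]
    [FiniteDimensional ℂ W] (ρ : G →* Module.End ℂ W) (d : G) (C : Finset G)
    (hC : ∀ c, c ∈ C ↔ IsConj d c) (a : ℕ) (hcard : C.card = 2 ^ a) (ω : ℂ)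
    (hω : IsIntegral ℤ ω) (hω0 : ω ≠ 0) (T : Subgroup G)
    (hT : ∀ K : Subgroup G, K.Normal → (∀ x, x * d * x⁻¹ * d⁻¹ ∈ K) → T ≤ K)
    (hm : finrank ℂ ((∑ c ∈ C, ρ c).maxGenEigenspace ω) ≠ 0)
    (hodd : Odd (finrank ℂ ((∑ c ∈ C, ρ c).maxGenEigenspace ω)) ∨ ω = 2 ^ a) :
    ∀ t ∈ T, ∀ v ∈ (∑ c ∈ C, ρ c).maxGenEigenspace ω, ρ t v = v := by
  classical
  set Kh := ∑ c ∈ C, ρ c with hKh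
  set V := Kh.maxGenEigenspace ω with hV
  have hcomm : ∀ x : G, Commute Kh (ρ x) := by
    intro x
    have : ρ x * Kh = Kh * ρ x := by
      rw [hKh, Finset.mul_sum, Finset.sum_mul]
      refine Finset.sum_bij (fun c _ => x * c * x⁻¹) ?_ ?_ ?_ ?_
      · intro c hc
        rw [hC] at hc ⊢
        exact hc.trans (isConj_iff.2 ⟨x, rfl⟩)
      · intro c _ c' _ h
        simpa using h
      · intro c hc
        refine ⟨x⁻¹ * c * x, ?_, by group⟩
        rw [hC] at hc ⊢
        exact hc.trans (isConj_iff.2 ⟨x⁻¹, by group⟩)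
      · intro c _
        rw [← map_mul, ← map_mul]
        congr 1; group
    exact this.symm
  have hmaps : ∀ x : G, ∀ v ∈ V, ρ x v ∈ V := fun x v hv =>
    Module.End.mapsTo_maxGenEigenspace_of_comm (hcomm x) ω hv
  let σ : G →* Module.End ℂ V :=
    { toFun := fun x => (ρ x).restrict (hmaps x)
      map_one' := by ext v; simp
      map_mul' := by intro x y; ext v; simp }
  have hσ : ∀ x (v : V), ((σ x v : V) : W) = ρ x v := fun x v => rfl
  have hmaps2 : ∀ v ∈ V, Kh v ∈ V := fun v hv =>
    Module.End.mapsTo_maxGenEigenspace_of_comm (Commute.refl Kh) ω hv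
  have hsum : ∑ c ∈ C, σ c = Kh.restrict hmaps2 := by
    ext v
    simp [hKh, LinearMap.sum_apply, hσ]
  have htr1 : LinearMap.trace ℂ V (Kh.restrict hmaps2) = ω * (finrank ℂ V : ℂ) := by
    have hnil := Module.End.isNilpotent_restrict_maxGenEigenspace_sub_algebraMap Kh ω
    have h0 := (LinearMap.isNilpotent_trace_of_isNilpotent hnil).eq_zero
    have h1 : ((Kh - algebraMap ℂ (Module.End ℂ W) ω).restrict
        (Module.End.mapsTo_maxGenEigenspace_of_comm (Algebra.mul_sub_algebraMap_commutes Kh ω) ω))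
        = Kh.restrict hmaps2 - ω • (1 : Module.End ℂ V) := by
      ext v; change (Kh - algebraMap ℂ (Module.End ℂ W) ω) v = Kh v - ω • (v:W); simp
    rw [h1, map_sub, map_smul, LinearMap.trace_one, sub_eq_zero] at h0
    rw [h0]; rfl
  have htr2 : ∀ c ∈ C, LinearMap.trace ℂ V (σ c) = LinearMap.trace ℂ V (σ d) := by
    intro c hc
    obtain ⟨x, rfl⟩ := isConj_iff.1 ((hC c).1 hc)
    rw [map_mul, LinearMap.trace_mul_comm, ← map_mul]
    congr 2; group
  set t := LinearMap.trace ℂ V (σ d) with ht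
  have key : (2 ^ a : ℂ) * t = ω * (finrank ℂ V : ℂ) := by
    rw [← htr1, ← hsum, map_sum, Finset.sum_congr rfl htr2, Finset.sum_const, hcard]
    simp
  have he : Nat.card G ≠ 0 := Nat.card_pos.ne'
  have hD : (σ d) ^ (Nat.card G) = 1 := by
    rw [← map_pow, pow_card_eq_one', map_one]
  have hti : IsIntegral ℤ t := kaz_trace_int _ _ he hD
  have hmC : (finrank ℂ V : ℂ) ≠ 0 := by exact_mod_cast hm
  have h2C : (2 ^ a : ℂ) ≠ 0 := pow_ne_zero _ two_ne_zero
  set x : ℂ := t / (finrank ℂ V : ℂ) with hx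
  have hxm : x * (finrank ℂ V : ℂ) = t := by rw [hx]; field_simp
  have hx2 : 2 ^ a * x = ω := by
    rw [hx]; field_simp; rw [key, mul_comm]
  have hxi : IsIntegral ℤ x := by
    rcases hodd with hodd | hodd
    · have hcop : IsCoprime ((2 ^ a : ℕ) : ℤ) ((finrank ℂ V : ℕ) : ℤ) := by
        rw [Nat.isCoprime_iff_coprime]
        exact Nat.Coprime.pow_left _ (Nat.coprime_two_left.2 hodd)
      obtain ⟨u, v, huv⟩ := hcop
      have huv' : (u : ℂ) * 2 ^ a + v * (finrank ℂ V : ℂ) = 1 := by exact_mod_cast huv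
      have : x = u * ω + v * t := by
        calc x = ((u : ℂ) * 2 ^ a + v * (finrank ℂ V : ℂ)) * x := by rw [huv', one_mul]
          _ = u * (2 ^ a * x) + v * (x * (finrank ℂ V : ℂ)) := by ring
          _ = _ := by rw [hx2, hxm]
      rw [this]
      have hZ : ∀ u : ℤ, IsIntegral ℤ (u : ℂ) := fun u => isIntegral_algebraMap (R := ℤ) (x := u)
      exact ((hZ u).mul hω).add ((hZ v).mul hti)
    · have : x = 1 := by
        rw [hodd] at hx2
        exact mul_left_cancel₀ h2C (by rw [hx2, mul_one])
      rw [this]; exact isIntegral_one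
  have hx0 : x ≠ 0 := by
    rintro h; rw [h, mul_zero] at hx2; exact hω0 hx2.symm
  have hscal := kaz_scalar (σ d) _ he hD hm x hxm hxi hx0
  have hKer := hT σ.ker inferInstance (by
    intro y
    rw [MonoidHom.mem_ker, mul_assoc, mul_assoc, map_mul, map_mul, map_mul, hscal]
    rw [← mul_assoc, ← Algebra.commutes x (σ y), mul_assoc, ← mul_assoc (σ y), ← map_mul,
      mul_inv_cancel, map_one, one_mul, ← hscal, ← map_mul, mul_inv_cancel, map_one])
  intro t' ht' v hv
  have := hKer ht'
  rw [MonoidHom.mem_ker] at this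
  have h3 := hσ t' ⟨v, hv⟩
  rw [this] at h3
  exact h3.symm


open Classical in
noncomputable def monMat {G : Type*} [Group G] {R : Type*} [CommRing R] (H : Subgroup G)
    (χ : H →* R) (g : G) : Matrix (G ⧸ H) (G ⧸ H) R :=
  fun j i => if h : j.out⁻¹ * g * i.out ∈ H then χ ⟨_, h⟩ else 0

lemma monMat_mem_iff {G : Type*} [Group G] (H : Subgroup G) (g : G) (i j : G ⧸ H) :
    j.out⁻¹ * g * i.out ∈ H ↔ j = g • i := by
  conv_rhs => rw [← QuotientGroup.out_eq' j, ← QuotientGroup.out_eq' i]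
  rw [MulAction.Quotient.smul_mk, QuotientGroup.eq, smul_eq_mul, mul_assoc]

noncomputable def monRep {G : Type*} [Group G] [Finite G] {R : Type*} [CommRing R] (H : Subgroup G)
    [Fintype (G ⧸ H)] [DecidableEq (G ⧸ H)] (χ : H →* R) : G →* Matrix (G ⧸ H) (G ⧸ H) R where
  toFun := monMat H χ
  map_one' := by
    ext j i
    unfold monMat
    by_cases h : j = i
    · subst h
      have : j.out⁻¹ * 1 * j.out = 1 := by group
      rw [Matrix.one_apply_eq, dif_pos (by rw [this]; exact H.one_mem)]
      rw [← map_one χ]; congr 1; ext; simp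
    · rw [Matrix.one_apply_ne h, dif_neg]
      rw [monMat_mem_iff, one_smul]; exact h
  map_mul' := by
    intro g g'
    ext j i
    rw [Matrix.mul_apply, Finset.sum_eq_single (g' • i)]
    · unfold monMat
      have h2 : (g' • i).out⁻¹ * g' * i.out ∈ H := (monMat_mem_iff H g' i _).2 rfl
      by_cases h : j.out⁻¹ * (g * g') * i.out ∈ H
      · have h1 : j.out⁻¹ * g * (g' • i).out ∈ H := by
          rw [monMat_mem_iff] at h ⊢
          rw [h, mul_smul]
        rw [dif_pos h, dif_pos h1, dif_pos h2, ← map_mul]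
        congr 1
        ext
        simp only [Subgroup.coe_mul]
        group
      · have h1 : ¬ j.out⁻¹ * g * (g' • i).out ∈ H := by
          rw [monMat_mem_iff] at h ⊢
          rwa [mul_smul] at h
        rw [dif_neg h, dif_neg h1, zero_mul]
    · intro k _ hk
      have : monMat H χ g' k i = 0 := by
        unfold monMat
        rw [dif_neg]
        rw [monMat_mem_iff]; exact hk
      rw [this, mul_zero]
    · intro h; exact absurd (Finset.mem_univ _) h

lemma monRep_apply {G : Type*} [Group G] [Finite G] {R : Type*} [CommRing R] (H : Subgroup G)
    [Fintype (G ⧸ H)] [DecidableEq (G ⧸ H)] (χ : H →* R) (g : G) : monRep H χ g = monMat H χ g := rfl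

lemma monMat_map {G : Type*} [Group G] {R S : Type*} [CommRing R] [CommRing S] (H : Subgroup G)
    (χ : H →* R) (φ : R →+* S) (g : G) :
    (monMat H χ g).map φ = monMat H ((φ : R →* S).comp χ) g := by
  ext j i
  rw [Matrix.map_apply]
  unfold monMat
  split_ifs <;> simp

abbrev KO := integralClosure ℤ ℂ

/-- the multiset of roots of a monic polynomial over the algebraic integers -/
lemma KO_split (p : Polynomial KO) (hp : p.Monic) :
    ∃ s : Multiset KO, p = (s.map (fun a => Polynomial.X - Polynomial.C a)).prod := by
  set q := p.map (algebraMap KO ℂ) with hq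
  have hqm : q.Monic := hp.map _
  have hs : q = (q.roots.map (fun a => Polynomial.X - Polynomial.C a)).prod :=
    (IsAlgClosed.splits q).eq_prod_roots_of_monic hqm
  have hint : ∀ z ∈ q.roots, z ∈ KO := by
    intro z hz
    have h1 : IsIntegral KO z := by
      refine ⟨p, hp, ?_⟩
      have := (Polynomial.mem_roots'.1 hz).2
      rwa [hq, Polynomial.IsRoot, Polynomial.eval_map] at this
    exact isIntegral_trans (R := ℤ) (A := KO) z h1
  obtain ⟨s, hs'⟩ : ∃ s' : Multiset KO, s'.map (algebraMap KO ℂ) = q.roots := by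
    refine ⟨q.roots.attach.map (fun z => ⟨z.1, hint z.1 z.2⟩), ?_⟩
    rw [Multiset.map_map]
    conv_rhs => rw [← Multiset.attach_map_val q.roots]
    rfl
  refine ⟨s, ?_⟩
  apply Polynomial.map_injective (algebraMap KO ℂ) (FaithfulSMul.algebraMap_injective KO ℂ)
  rw [← hq, hs, ← hs', Polynomial.map_multiset_prod, Multiset.map_map, Multiset.map_map]
  congr 1
  apply Multiset.map_congr rfl
  intro z _
  simp

lemma KO_maximal (l : ℕ) (hl : l.Prime) : ∃ m : Ideal KO, m.IsMaximal ∧ (l : KO) ∈ m := by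
  have : (Ideal.span {(l : KO)}) ≠ ⊤ := by
    intro h
    rw [Ideal.span_singleton_eq_top, isUnit_iff_exists_inv] at h
    obtain ⟨b, hb⟩ := h
    have hb' : (l : ℂ) * (b : ℂ) = 1 := by exact_mod_cast congrArg (Subtype.val) hb
    have hl0 : (l : ℂ) ≠ 0 := by exact_mod_cast hl.ne_zero
    have h1 : IsIntegral ℤ (algebraMap ℚ ℂ ((1 : ℚ) / l)) := by
      have : algebraMap ℚ ℂ ((1 : ℚ) / l) = b := by
        simp only [one_div, map_inv₀, map_natCast]
        field_simp; rw [hb']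
      rw [this]; exact b.2
    rw [isIntegral_algebraMap_iff (algebraMap ℚ ℂ).injective] at h1
    obtain ⟨z, hz⟩ := IsIntegrallyClosed.isIntegral_iff.1 h1
    have hl0' : (l : ℚ) ≠ 0 := by exact_mod_cast hl.ne_zero
    have h2 : (z : ℚ) * l = 1 := by
      rw [show (z : ℚ) = 1 / l from hz]; field_simp
    have h3 : z * l = 1 := by exact_mod_cast h2
    have h4 := Int.isUnit_iff.1 (IsUnit.of_mul_eq_one_right _ h3)
    have := hl.two_le
    omega
  obtain ⟨m, hm, hle⟩ := Ideal.exists_le_maximal _ this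
  exact ⟨m, hm, hle (Ideal.mem_span_singleton_self _)⟩


open Module in
lemma kaz_exists {G : Type*} [Group G] [Finite G] (H : Subgroup G) [Fintype (G ⧸ H)]
    [DecidableEq (G ⧸ H)] (C : Finset G) (χ : H →* KO) :
    ∃ (s : Multiset KO) (ρ : G →* Module.End ℂ (G ⧸ H → ℂ)),
      (∑ c ∈ C, monRep H χ c).charpoly = (s.map (fun a => Polynomial.X - Polynomial.C a)).prod ∧
      (∀ g v j, ρ g v j = ∑ i, ((monMat H χ g j i : KO) : ℂ) * v i) ∧
      (∀ ω : KO, ∀ inst : DecidableEq KO, s.count ω =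
        finrank ℂ ((∑ c ∈ C, ρ c).maxGenEigenspace (ω : ℂ))) := by
  classical
  obtain ⟨s, hs⟩ := KO_split _ (Matrix.charpoly_monic (∑ c ∈ C, monRep H χ c))
  let φ : Matrix (G ⧸ H) (G ⧸ H) KO →+* Module.End ℂ (G ⧸ H → ℂ) :=
    (Matrix.toLinAlgEquiv' (R := ℂ) (n := G ⧸ H)).toRingEquiv.toRingHom.comp
      (algebraMap KO ℂ).mapMatrix
  let ρ : G →* Module.End ℂ (G ⧸ H → ℂ) := (φ : _ →* _).comp (monRep H χ)
  refine ⟨s, ρ, hs, ?_, ?_⟩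
  · intro g v j
    rfl
  · intro ω inst
    have h1 : ∑ c ∈ C, ρ c = Matrix.toLin' ((algebraMap KO ℂ).mapMatrix (∑ c ∈ C, monRep H χ c)) := by
      have : ∑ c ∈ C, ρ c = φ (∑ c ∈ C, monRep H χ c) := by rw [map_sum]; rfl
      rw [this]; rfl
    rw [LinearMap.finrank_maxGenEigenspace_eq, h1, Matrix.charpoly_toLin']
    rw [RingHom.mapMatrix_apply, Matrix.charpoly_map, hs]
    rw [Polynomial.map_multiset_prod, Multiset.map_map]
    have h2 : (s.map (Polynomial.map (algebraMap KO ℂ) ∘ fun a => Polynomial.X - Polynomial.C a)).prod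
      = ((s.map (algebraMap KO ℂ)).map (fun a => Polynomial.X - Polynomial.C a)).prod := by
      rw [Multiset.map_map]; congr 1; apply Multiset.map_congr rfl; intro z _; simp
    rw [h2, ← Polynomial.count_roots, Polynomial.roots_multiset_prod_X_sub_C]
    exact (Multiset.count_map_eq_count' (algebraMap KO ℂ) s (FaithfulSMul.algebraMap_injective KO ℂ) ω).symm

lemma card_filter_even {α : Type*} [DecidableEq α] (s : Multiset α) (P : α → Prop) [DecidablePred P]
    (h : ∀ x, P x → Even (s.count x)) : Even (Multiset.card (s.filter P)) := by
  rw [← Multiset.toFinset_sum_count_eq]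
  apply Finset.even_sum
  intro x hx
  have hx' := (Multiset.mem_filter.1 (Multiset.mem_toFinset.1 hx)).2
  rw [Multiset.count_filter_of_pos hx']
  exact h x hx'

lemma card_filter_odd {α : Type*} [DecidableEq α] (s : Multiset α) (P : α → Prop) [DecidablePred P]
    (x₀ : α) (hx₀ : P x₀) (h0 : Odd (s.count x₀))
    (h : ∀ x, x ≠ x₀ → P x → Even (s.count x)) : Odd (Multiset.card (s.filter P)) := by
  rw [← Multiset.toFinset_sum_count_eq]
  have hmem : x₀ ∈ (s.filter P).toFinset := by
    rw [Multiset.mem_toFinset, Multiset.mem_filter]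
    exact ⟨Multiset.count_pos.1 h0.pos, hx₀⟩
  rw [← Finset.add_sum_erase _ _ hmem, Multiset.count_filter_of_pos hx₀]
  apply Odd.add_even h0
  apply Finset.even_sum
  intro x hx
  have hx1 := (Finset.mem_erase.1 hx).1
  have hx' := (Multiset.mem_filter.1 (Multiset.mem_toFinset.1 (Finset.mem_erase.1 hx).2)).2
  rw [Multiset.count_filter_of_pos hx']
  exact h x hx1 hx'

open Module in
theorem kaz_core {G : Type*} [Group G] [Finite G] (T H : Subgroup G) [T.Normal] (d : G) (C : Finset G)
    (hC : ∀ c, c ∈ C ↔ IsConj d c) (a : ℕ) (hcard : C.card = 2 ^ a)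
    (hT : ∀ K : Subgroup G, K.Normal → (∀ x, x * d * x⁻¹ * d⁻¹ ∈ K) → T ≤ K)
    (hTH : ∀ x : G, ∃ t ∈ T, ∃ h ∈ H, x = t * h) (l : ℕ) (hl : l.Prime) (hl2 : l ≠ 2)
    (χ : H →* KO) (hχ : ∀ h, χ h ^ l = 1) (r : G) (hrT : r ∈ T) (hrH : r ∈ H)
    (hr : χ ⟨r, hrH⟩ ≠ 1) : False := by
  classical
  have : Fintype (G ⧸ H) := Fintype.ofFinite _
  obtain ⟨m, hm, hlm⟩ := KO_maximal l hl
  let F := KO ⧸ m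
  let _ : Field F := Ideal.Quotient.field m
  let q : KO →+* F := Ideal.Quotient.mk m
  have hlF : (l : F) = 0 := by
    have : q (l : KO) = 0 := Ideal.Quotient.eq_zero_iff_mem.2 hlm
    simpa using this
  have : Fact l.Prime := ⟨hl⟩
  have hchar : CharP F l := by
    have := CharP.ringChar_of_prime_eq_zero hl hlF
    rw [← this]; infer_instance
  have h2F : (2 : F) ^ a ≠ 0 := by
    apply pow_ne_zero
    intro h
    have : (l : ℕ) ∣ 2 := (CharP.cast_eq_zero_iff F l 2).1 (by exact_mod_cast h)
    exact hl2 ((Nat.prime_dvd_prime_iff_eq hl Nat.prime_two).1 this)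
  have hχ1 : (q : KO →* F).comp χ = (q : KO →* F).comp 1 := by
    ext h
    have h1 : (q (χ h)) ^ l = 1 := by rw [← map_pow, hχ, map_one]
    have h2 : (q (χ h) - 1) ^ l = 0 := by rw [sub_pow_char, h1, one_pow, sub_self]
    have h3 := pow_eq_zero_iff hl.ne_zero |>.1 h2
    simpa [sub_eq_zero] using h3
  obtain ⟨s₁, ρ₁, hs₁, hρ₁, hc₁⟩ := kaz_exists H C (1 : H →* KO)
  obtain ⟨s₂, ρ₂, hs₂, hρ₂, hc₂⟩ := kaz_exists H C χ
  have hmap : ∀ χ' : H →* KO, q.mapMatrix (∑ c ∈ C, monRep H χ' c)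
      = ∑ c ∈ C, monMat H ((q : KO →* F).comp χ') c := by
    intro χ'
    rw [map_sum]
    apply Finset.sum_congr rfl
    intro c _
    exact monMat_map H χ' q c
  have hss : s₁.map q = s₂.map q := by
    have e1 : ∀ s : Multiset KO, s.map q =
        (((s.map (fun a => Polynomial.X - Polynomial.C a)).prod).map q).roots := by
      intro s
      rw [Polynomial.map_multiset_prod, Multiset.map_map]
      have h2 : (s.map (Polynomial.map q ∘ fun a => Polynomial.X - Polynomial.C a)).prod
        = ((s.map q).map (fun a => Polynomial.X - Polynomial.C a)).prod := by
        rw [Multiset.map_map]; congr 1; apply Multiset.map_congr rfl; intro z _; simp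
      rw [h2, Polynomial.roots_multiset_prod_X_sub_C]
    rw [e1 s₁, e1 s₂, ← hs₁, ← hs₂, ← Matrix.charpoly_map, ← Matrix.charpoly_map,
      ← RingHom.mapMatrix_apply, ← RingHom.mapMatrix_apply, hmap, hmap, hχ1]
  have hfil : Multiset.card (s₁.filter (fun x => (2:F) ^ a = q x)) =
      Multiset.card (s₂.filter (fun x => (2:F) ^ a = q x)) := by
    have := congrArg (Multiset.count ((2:F) ^ a)) hss
    rw [Multiset.count_map, Multiset.count_map] at this
    convert this
  have hne : ∀ ω : KO, (2:F) ^ a = q ω → (ω : ℂ) ≠ 0 := by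
    intro ω hω h
    have : ω = 0 := Subtype.ext h
    rw [this, map_zero] at hω
    exact h2F hω
  have heven : Even (Multiset.card (s₂.filter (fun x => (2:F) ^ a = q x))) := by
    apply card_filter_even
    intro ω hω
    by_contra hodd
    rw [Nat.not_even_iff_odd] at hodd
    rw [hc₂ ω] at hodd
    have hm0 := hodd.pos.ne'
    have hfix := kaz_rep ρ₂ d C hC a hcard (ω : ℂ) ω.2 (hne ω hω) T hT hm0 (Or.inl hodd)
    have hbot : ((∑ c ∈ C, ρ₂ c).maxGenEigenspace (ω : ℂ)) = ⊥ := by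
      rw [eq_bot_iff]
      intro v hv
      rw [Submodule.mem_bot]
      ext j
      have h1 := congrFun (hfix (j.out * r * j.out⁻¹) (Subgroup.Normal.conj_mem inferInstance r hrT _) v hv) j
      rw [hρ₂, Finset.sum_eq_single j] at h1
      · have h3 : j.out⁻¹ * (j.out * r * j.out⁻¹) * j.out = r := by group
        have h2 : monMat H χ (j.out * r * j.out⁻¹) j j = χ ⟨r, hrH⟩ := by
          unfold monMat
          rw [dif_pos (by rw [h3]; exact hrH)]
          congr 1
          exact Subtype.ext h3
        rw [h2] at h1
        have h4 : ((χ ⟨r, hrH⟩ : ℂ) - 1) * v j = 0 := by rw [sub_mul, h1]; ring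
        rcases mul_eq_zero.1 h4 with h | h
        · exact absurd (Subtype.ext (sub_eq_zero.1 h)) hr
        · simpa using h
      · intro i _ hij
        have : monMat H χ (j.out * r * j.out⁻¹) j i = 0 := by
          unfold monMat
          rw [dif_neg]
          intro h
          have h3 : j.out⁻¹ * (j.out * r * j.out⁻¹) * i.out = r * (j.out⁻¹ * i.out) := by group
          rw [h3, Subgroup.mul_mem_cancel_left _ hrH, ← QuotientGroup.eq] at h
          exact hij (by simpa using h.symm)
        rw [this]; simp
      · intro h; exact absurd (Finset.mem_univ _) h
    rw [hbot] at hm0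
    simp at hm0
  -- the trivial character
  have hsmul : ∀ g v j, ρ₁ g v (g • j) = v j := by
    intro g v j
    rw [hρ₁, Finset.sum_eq_single j]
    · have : monMat H (1 : H →* KO) g (g • j) j = 1 := by
        unfold monMat
        rw [dif_pos ((monMat_mem_iff H g j _).2 rfl)]
        simp
      rw [this]; simp
    · intro i _ hij
      have : monMat H (1 : H →* KO) g (g • j) i = 0 := by
        unfold monMat
        rw [dif_neg]
        rw [monMat_mem_iff]
        intro h
        exact hij (MulAction.injective g h).symm
      rw [this]; simp
    · intro h; exact absurd (Finset.mem_univ _) h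
  let one : G ⧸ H → ℂ := fun _ => 1
  have hone : ∀ g, ρ₁ g one = one := by
    intro g
    ext j
    have := hsmul g one (g⁻¹ • j)
    rwa [smul_inv_smul] at this
  have hKone : (∑ c ∈ C, ρ₁ c) one = (2 ^ a : ℂ) • one := by
    rw [LinearMap.sum_apply, Finset.sum_congr rfl (fun c _ => hone c), Finset.sum_const, hcard]
    ext j; simp
  have hconst : ∀ v : G ⧸ H → ℂ, (∀ t ∈ T, ρ₁ t v = v) → v ∈ Submodule.span ℂ {one} := by
    intro v hv
    rw [Submodule.mem_span_singleton]
    refine ⟨v (QuotientGroup.mk 1), ?_⟩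
    ext j
    obtain ⟨t, ht, h, hh, hth⟩ := hTH j.out
    have hj : j = t • (QuotientGroup.mk 1 : G ⧸ H) := by
      rw [← QuotientGroup.out_eq' j, hth, MulAction.Quotient.smul_mk, QuotientGroup.eq]
      simpa using hh
    have := hsmul t v (QuotientGroup.mk 1)
    rw [hv t ht, ← hj] at this
    simp [one, this]
  have hone0 : one ≠ 0 := by
    intro h
    have := congrFun h (QuotientGroup.mk 1)
    simp [one] at this
  have hle : ∀ ω : KO, (2:F) ^ a = q ω →
      finrank ℂ ((∑ c ∈ C, ρ₁ c).maxGenEigenspace (ω : ℂ)) ≠ 0 →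
      (Odd (finrank ℂ ((∑ c ∈ C, ρ₁ c).maxGenEigenspace (ω : ℂ))) ∨ (ω : ℂ) = 2 ^ a) →
      ((∑ c ∈ C, ρ₁ c).maxGenEigenspace (ω : ℂ)) = Submodule.span ℂ {one} := by
    intro ω hω hm0 hodd
    have hfix := kaz_rep ρ₁ d C hC a hcard (ω : ℂ) ω.2 (hne ω hω) T hT hm0 hodd
    have hle : ((∑ c ∈ C, ρ₁ c).maxGenEigenspace (ω : ℂ)) ≤ Submodule.span ℂ {one} :=
      fun v hv => hconst v (fun t ht => hfix t ht v hv)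
    apply Submodule.eq_of_le_of_finrank_le hle
    rw [finrank_span_singleton hone0]
    omega
  have hq2 : (2:F)^a = q (2 ^ a) := by rw [map_pow, map_ofNat]
  have hco : ((2 ^ a : KO) : ℂ) = 2 ^ a := by
    have := map_pow (algebraMap KO ℂ) 2 a
    rwa [map_ofNat] at this
  have hone_mem : one ∈ (∑ c ∈ C, ρ₁ c).maxGenEigenspace (((2 ^ a : KO)) : ℂ) := by
    rw [Module.End.mem_maxGenEigenspace]
    refine ⟨1, ?_⟩
    rw [pow_one, LinearMap.sub_apply, hKone, hco]
    simp
  have hodd : Odd (Multiset.card (s₁.filter (fun x => (2:F) ^ a = q x))) := by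
    apply card_filter_odd _ _ (2 ^ a) hq2
    · rw [hc₁]
      have hm0 : finrank ℂ ((∑ c ∈ C, ρ₁ c).maxGenEigenspace (((2 ^ a : KO)) : ℂ)) ≠ 0 := by
        intro h
        rw [Submodule.finrank_eq_zero] at h
        rw [h, Submodule.mem_bot] at hone_mem
        exact hone0 hone_mem
      rw [hle _ hq2 hm0 (Or.inr hco), finrank_span_singleton hone0]
      exact odd_one
    · intro ω hne2 hω
      by_contra hodd
      rw [Nat.not_even_iff_odd] at hodd
      rw [hc₁] at hodd
      have h1 := hle ω hω hodd.pos.ne' (Or.inl hodd)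
      have h2 : one ∈ (∑ c ∈ C, ρ₁ c).maxGenEigenspace (ω : ℂ) := by
        rw [h1]; exact Submodule.mem_span_singleton_self _
      have h3 := Module.End.disjoint_genEigenspace (∑ c ∈ C, ρ₁ c)
        (μ₁ := (((2 ^ a : KO)) : ℂ)) (μ₂ := (ω : ℂ))
        (fun h => hne2 (Subtype.ext h.symm)) ⊤ ⊤
      exact hone0 (Submodule.disjoint_def.1 h3 one hone_mem h2)
  rw [hfil] at hodd
  exact (Nat.not_even_iff_odd.2 hodd) heven


lemma card_range_eq_index {T β : Type*} [Group T] (K : Subgroup T) (f : T → β)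
    (hf : ∀ s t, f s = f t ↔ s⁻¹ * t ∈ K) : Nat.card (Set.range f) = K.index := by
  rw [Subgroup.index]
  symm
  let F : T ⧸ K → Set.range f := fun x => Quotient.liftOn' x (fun t => ⟨f t, t, rfl⟩)
    (fun s t h => Subtype.ext ((hf s t).2 (QuotientGroup.leftRel_apply.1 h)))
  apply Nat.card_congr (Equiv.ofBijective F ⟨?_, ?_⟩)
  · intro x y
    induction x using QuotientGroup.induction_on
    induction y using QuotientGroup.induction_on
    intro h
    rw [QuotientGroup.eq]
    exact (hf _ _).1 (congrArg Subtype.val h)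
  · rintro ⟨_, t, rfl⟩
    exact ⟨QuotientGroup.mk t, rfl⟩

lemma exists_odd_prime_dvd {T : Type*} [Group T] [Finite T] [IsSimpleGroup T]
    (hna : ¬ ∀ a b : T, a * b = b * a) : ∃ l : ℕ, l.Prime ∧ l ≠ 2 ∧ l ∣ Nat.card T := by
  by_contra hcon
  push Not at hcon
  have h2 : ∃ k, Nat.card T = 2 ^ k :=
    ⟨_, Nat.eq_prime_pow_of_unique_prime_dvd Nat.card_pos.ne'
      (fun {d} hd hdv => by by_contra h; exact hcon d hd h hdv)⟩
  obtain ⟨k, hk⟩ := h2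
  have : Fact (Nat.Prime 2) := ⟨Nat.prime_two⟩
  have hp : IsPGroup 2 T := IsPGroup.of_card hk
  have : Nontrivial (Subgroup.center T) := hp.center_nontrivial
  have hc : Subgroup.center T = ⊤ := by
    rcases Subgroup.Normal.eq_bot_or_eq_top (H := Subgroup.center T) inferInstance with h | h
    · rw [h] at this
      exact absurd this (not_nontrivial _)
    · exact h
  apply hna
  intro a b
  have : b ∈ Subgroup.center T := by rw [hc]; trivial
  exact (Subgroup.mem_center_iff.1 this a)

lemma KO_char {T : Type*} [Group T] [Finite T] (r : T) (hr : r ≠ 1) :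
    ∃ χ : Subgroup.zpowers r →* KO, χ ⟨r, Subgroup.mem_zpowers r⟩ ≠ 1 := by
  have hne : (⟨r, Subgroup.mem_zpowers r⟩ : Subgroup.zpowers r) ≠ 1 := by
    intro h; exact hr (congrArg Subtype.val h)
  let _ : CommGroup (Subgroup.zpowers r) := IsCyclic.commGroup
  obtain ⟨ψ, hψ⟩ := CommGroup.exists_apply_ne_one_of_hasEnoughRootsOfUnity (Subgroup.zpowers r) ℂ hne
  have hint : ∀ y, IsIntegral ℤ ((ψ y : ℂˣ) : ℂ) := by
    intro y
    refine IsIntegral.of_pow (n := Nat.card (Subgroup.zpowers r)) Nat.card_pos ?_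
    rw [← Units.val_pow_eq_pow_val, ← map_pow, pow_card_eq_one', map_one]
    exact isIntegral_one
  refine ⟨{ toFun := fun y => ⟨((ψ y : ℂˣ) : ℂ), hint y⟩, map_one' := ?_, map_mul' := ?_ }, ?_⟩
  · apply Subtype.ext; simp
  · intro x y; apply Subtype.ext; simp
  · intro h
    have := congrArg Subtype.val h
    apply hψ
    apply Units.ext
    simpa using this

theorem kazarin {T : Type*} [Group T] [Finite T] [IsSimpleGroup T]
    (hna : ¬ ∀ a b : T, a * b = b * a) (δ : MulAut T) (F : Subgroup T)
    (hF : ∀ t, t ∈ F ↔ δ t = t) (a : ℕ) (hidx : F.index = 2 ^ a) : δ = 1 := by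
  classical
  by_contra hδ
  obtain ⟨l, hl, hl2, hdv⟩ := exists_odd_prime_dvd hna
  have hlF : l ∣ Nat.card F := by
    rw [← Subgroup.card_mul_index F, hidx] at hdv
    rcases (Nat.Prime.dvd_mul hl).1 hdv with h | h
    · exact h
    · exact absurd ((Nat.prime_dvd_prime_iff_eq hl Nat.prime_two).1 (hl.dvd_of_dvd_pow h)) hl2
  have : Fact l.Prime := ⟨hl⟩
  obtain ⟨r', hr'⟩ := exists_prime_orderOf_dvd_card' l hlF
  set r : T := r'.1 with hrdef
  have hro : orderOf r = l := by rw [hrdef, Subgroup.orderOf_coe]; exact hr'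
  have hrδ : δ r = r := (hF r).1 r'.2
  have hr1 : r ≠ 1 := by
    intro h; rw [h, orderOf_one] at hro; exact hl.one_lt.ne hro
  obtain ⟨χ₀, hχ₀⟩ := KO_char r hr1
  let Z := Subgroup.zpowers δ
  let G := T ⋊[Z.subtype] Z
  have hfinZ : Finite (MulAut T) := Finite.of_injective (fun e : MulAut T => (e : T → T)) DFunLike.coe_injective
  have hfinG : Finite G := Finite.of_equiv _ (SemidirectProduct.equivProd (φ := Z.subtype)).symm
  let d : G := SemidirectProduct.inr ⟨δ, Subgroup.mem_zpowers δ⟩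
  have hml : ∀ x y : G, (x * y).left = x.left * (x.right : MulAut T) y.left := fun _ _ => rfl
  have hmr : ∀ x y : G, (x * y).right = x.right * y.right := fun _ _ => rfl
  have hil : ∀ x : G, (x⁻¹).left = ((x.right⁻¹ : Z) : MulAut T) (x.left)⁻¹ := fun _ => rfl
  have hir : ∀ x : G, (x⁻¹).right = x.right⁻¹ := fun _ => rfl
  have hZr : ∀ z : Z, (z : MulAut T) r = r := by
    rintro ⟨z, hz⟩
    have : Z ≤ MulAction.stabilizer (MulAut T) r := by
      rw [Subgroup.zpowers_le, MulAction.mem_stabilizer_iff]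
      exact hrδ
    exact MulAction.mem_stabilizer_iff.1 (this hz)
  have hZy : ∀ (z : Z) (y : T), y ∈ Subgroup.zpowers r → (z : MulAut T) y = y := by
    rintro z y ⟨k, rfl⟩
    simp only [map_zpow, hZr]
  let H : Subgroup G :=
    { carrier := {g | g.left ∈ Subgroup.zpowers r}
      one_mem' := by
        simp only [Set.mem_ofPred_eq, SemidirectProduct.one_left]; exact Subgroup.one_mem _
      mul_mem' := by
        intro x y hx hy
        simp only [Set.mem_ofPred_eq, hml] at hx hy ⊢
        rw [hZy _ _ hy]
        exact Subgroup.mul_mem _ hx hy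
      inv_mem' := by
        intro x hx
        simp only [Set.mem_ofPred_eq, hil] at hx ⊢
        rw [hZy _ _ (Subgroup.inv_mem _ hx)]
        exact Subgroup.inv_mem _ hx }
  let χ : H →* KO :=
    { toFun := fun h => χ₀ ⟨h.1.left, h.2⟩
      map_one' := by rw [← map_one χ₀]; rfl
      map_mul' := by
        intro x y
        rw [← map_mul]
        congr 1
        apply Subtype.ext
        simp only [Subgroup.coe_mul, hml]
        rw [hZy _ _ y.2] }
  let C : Finset G := (Set.toFinite {c : G | IsConj d c}).toFinset
  have hconj : ∀ t : T, SemidirectProduct.inl t * d * (SemidirectProduct.inl t)⁻¹ =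
      (⟨t * δ t⁻¹, ⟨δ, Subgroup.mem_zpowers δ⟩⟩ : G) := by
    intro t
    rw [← map_inv]
    apply SemidirectProduct.ext
    · simp [hml, hmr, d]
    · simp [hml, hmr, d]
  have hdz : ∀ z : Z, SemidirectProduct.inr z * d * (SemidirectProduct.inr z)⁻¹ = d := by
    intro z
    have hzz : z * ⟨δ, Subgroup.mem_zpowers δ⟩ * z⁻¹ = ⟨δ, Subgroup.mem_zpowers δ⟩ := by
      rw [mul_inv_eq_iff_eq_mul]
      exact mul_comm' z ⟨δ, Subgroup.mem_zpowers δ⟩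
    change SemidirectProduct.inr z * SemidirectProduct.inr _ * (SemidirectProduct.inr z)⁻¹ = SemidirectProduct.inr _
    rw [← map_mul, ← map_inv, ← map_mul, hzz]
  have hCc : C.card = 2 ^ a := by
    rw [← hidx, ← card_range_eq_index F (fun t => (⟨t * δ t⁻¹, ⟨δ, Subgroup.mem_zpowers δ⟩⟩ : G))]
    · rw [← Set.ncard_coe_finset, ← Nat.card_coe_set_eq]
      congr 2
      ext c
      simp only [C, Set.Finite.coe_toFinset, Set.mem_ofPred_eq, Set.mem_range]
      constructor
      · intro h
        obtain ⟨x, rfl⟩ := isConj_iff.1 h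
        refine ⟨x.left, ?_⟩
        rw [← hconj]
        conv_rhs => rw [← SemidirectProduct.inl_left_mul_inr_right x]
        have h5 : SemidirectProduct.inr x.right * d = d * (SemidirectProduct.inr x.right : G) :=
          mul_inv_eq_iff_eq_mul.1 (hdz x.right)
        rw [mul_assoc (SemidirectProduct.inl _) (SemidirectProduct.inr _) d, h5]
        group
      · rintro ⟨t, rfl⟩
        rw [← hconj]
        exact isConj_iff.2 ⟨_, rfl⟩
    · intro s t
      rw [hF]
      have : (⟨s * δ s⁻¹, ⟨δ, Subgroup.mem_zpowers δ⟩⟩ : G) = ⟨t * δ t⁻¹, ⟨δ, Subgroup.mem_zpowers δ⟩⟩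
          ↔ s * δ s⁻¹ = t * δ t⁻¹ := by
        constructor
        · intro h; exact congrArg SemidirectProduct.left h
        · intro h; rw [h]
      rw [this, map_inv, map_inv, map_mul, map_inv]
      constructor
      · intro h
        have h6 : δ s = (t * (δ t)⁻¹)⁻¹ * s := by rw [← h]; group
        rw [h6]; group
      · intro h
        have h6 : δ t = δ s * (s⁻¹ * t) := by rw [← h]; group
        rw [h6]; group
  have hker : ∀ K : Subgroup G, K.Normal → (∀ x, x * d * x⁻¹ * d⁻¹ ∈ K) →
      (SemidirectProduct.inl : T →* G).range ≤ K := by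
    intro K hK hx
    rcases (hK.comap (SemidirectProduct.inl : T →* G)).eq_bot_or_eq_top with h | h
    · exfalso
      apply hδ
      ext t
      have h1 := hx (SemidirectProduct.inl t)
      rw [hconj] at h1
      have h2 : (⟨t * δ t⁻¹, ⟨δ, Subgroup.mem_zpowers δ⟩⟩ : G) * d⁻¹ = SemidirectProduct.inl (t * δ t⁻¹) := by
        rw [mul_inv_eq_iff_eq_mul]
        apply SemidirectProduct.ext
        · simp [hml, hmr, d]
        · simp [hml, hmr, d]
      rw [h2, ← Subgroup.mem_comap, h, Subgroup.mem_bot, map_inv, mul_inv_eq_one] at h1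
      simpa using h1.symm
    · rintro _ ⟨t, rfl⟩
      have : t ∈ K.comap (SemidirectProduct.inl : T →* G) := by rw [h]; trivial
      exact this
  have hTn : ((SemidirectProduct.inl : T →* G).range).Normal := by
    rw [SemidirectProduct.range_inl_eq_ker_rightHom]; infer_instance
  have hrH : (SemidirectProduct.inl r : G) ∈ H := by
    change (SemidirectProduct.inl r : G).left ∈ Subgroup.zpowers r
    simp
  apply kaz_core (SemidirectProduct.inl : T →* G).range H d C (fun c => Set.Finite.mem_toFinset _) a hCc hker ?_ l hl hl2 χ ?_
    (SemidirectProduct.inl r) ⟨r, rfl⟩ hrH ?_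
  · intro x
    refine ⟨_, ⟨x.left, rfl⟩, SemidirectProduct.inr x.right, ?_, (SemidirectProduct.inl_left_mul_inr_right x).symm⟩
    change (SemidirectProduct.inr x.right : G).left ∈ Subgroup.zpowers r
    rw [SemidirectProduct.left_inr]; exact Subgroup.one_mem _
  · intro h
    change (χ₀ _) ^ l = 1
    rw [← map_pow]
    have : Nat.card (Subgroup.zpowers r) = l := by rw [Nat.card_zpowers, hro]
    rw [← this, pow_card_eq_one', map_one]
  · exact hχ₀


def autFix {S : Type*} [Group S] (W : Subgroup (MulAut S)) : Subgroup S where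
  carrier := {s | ∀ w ∈ W, w s = s}
  one_mem' := fun w _ => map_one w
  mul_mem' := fun {a b} ha hb w hw => by rw [map_mul, ha w hw, hb w hw]
  inv_mem' := fun {a} ha w hw => by rw [map_inv, ha w hw]

lemma mem_autFix {S : Type*} [Group S] (W : Subgroup (MulAut S)) (s : S) :
    s ∈ autFix W ↔ ∀ w ∈ W, w s = s := Iff.rfl

lemma orbit_exists {W U : Type*} [Group W] [Finite W] [MulAction W U] [Finite U] (D : ℕ)
    (h : ¬ D ∣ Nat.card U) : ∃ u : U, ¬ D ∣ Nat.card (MulAction.orbit W u) := by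
  classical
  by_contra hcon
  push Not at hcon
  apply h
  have : Fintype (MulAction.orbitRel.Quotient W U) := Fintype.ofFinite _
  rw [Nat.card_congr (MulAction.selfEquivSigmaOrbits W U), Nat.card_sigma]
  apply Finset.dvd_sum
  intro ω _
  exact hcon _

theorem autL1 {S : Type*} [Group S] [Finite S] (q r k : ℕ) (hq : q.Prime) (hr : r.Prime) (hqr : q ≠ r)
    (hS : Nat.card S = q ^ k) : ∀ (m : ℕ) (W : Subgroup (MulAut S)) (w i : ℕ), Nat.card W = r ^ w →
    Nat.card (autFix W) = q ^ i → k ≤ i + m →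
    w ≤ ∑ j ∈ Finset.Icc 1 m, padicValNat r (q ^ j - 1) := by
  classical
  have hfin : Finite (MulAut S) :=
    Finite.of_injective (fun e : MulAut S => (e : S → S)) DFunLike.coe_injective
  have : Fact r.Prime := ⟨hr⟩
  intro m
  induction m with
  | zero =>
    intro W w i hW hfix hk
    have htop : autFix W = ⊤ := by
      rw [← Subgroup.card_eq_iff_eq_top]
      apply le_antisymm (Subgroup.card_le_card_group _)
      rw [hfix, hS]
      exact Nat.pow_le_pow_right hq.pos (by omega)
    have hbot : W = ⊥ := by
      rw [eq_bot_iff]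
      intro x hx
      rw [Subgroup.mem_bot]
      ext s
      have : s ∈ autFix W := by rw [htop]; trivial
      exact this x hx
    rw [hbot, Subgroup.card_bot] at hW
    have := Nat.pow_right_injective hr.two_le (a₁ := 0) (a₂ := w) (by simpa using hW)
    omega
  | succ m ih =>
    intro W w i hW hfix hk
    by_cases hk2 : k ≤ i + m
    · exact (ih W w i hW hfix hk2).trans
        (Finset.sum_le_sum_of_subset (Finset.Icc_subset_Icc_right (by omega)))
    have hkim : k = i + (m + 1) := by omega
    let U : SubMulAction W S :=
      { carrier := {s | s ∉ autFix W}
        smul_mem' := by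
          rintro ⟨c, hc⟩ s hs hcs
          apply hs
          have h1 : c⁻¹ (c s) = c s := hcs c⁻¹ (W.inv_mem hc)
          have h2 : s = c s := by
            rw [← h1]; simp
          intro x hx
          rw [h2]; exact hcs x hx }
    have hUcard : Nat.card U = q ^ i * (q ^ (m + 1) - 1) := by
      have h1 : Nat.card U = Nat.card ((autFix W : Set S)ᶜ : Set S) := rfl
      have h2 := Set.ncard_add_ncard_compl (autFix W : Set S)
      rw [h1, Nat.card_coe_set_eq]
      have h3 : (autFix W : Set S).ncard = q ^ i := by rw [← hfix, ← Nat.card_coe_set_eq]; rfl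
      rw [h3, hS, hkim, pow_add] at h2
      rw [Nat.mul_sub, mul_one]
      omega
    have hpos : q ^ (m + 1) - 1 ≠ 0 := by
      have := Nat.one_lt_pow (n := m + 1) (by omega) hq.one_lt
      omega
    obtain ⟨u, hu⟩ := orbit_exists (W := W) (U := U) (r ^ (padicValNat r (q ^ (m + 1) - 1) + 1)) (by
      rw [hUcard]
      intro h
      have hc : Nat.Coprime (r ^ (padicValNat r (q ^ (m + 1) - 1) + 1)) (q ^ i) :=
        Nat.Coprime.pow _ _ ((Nat.coprime_primes hr hq).2 (Ne.symm hqr))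
      have := hc.dvd_of_dvd_mul_left h
      exact (pow_succ_padicValNat_not_dvd hpos) this)
    have horb : Nat.card (MulAction.orbit W u) * Nat.card (MulAction.stabilizer W u) = r ^ w := by
      rw [← hW]
      have : Fintype W := Fintype.ofFinite _
      have : Fintype (MulAction.orbit W u) := Fintype.ofFinite _
      have : Fintype (MulAction.stabilizer W u) := Fintype.ofFinite _
      rw [Nat.card_eq_fintype_card, Nat.card_eq_fintype_card, Nat.card_eq_fintype_card]
      exact MulAction.card_orbit_mul_card_stabilizer_eq_card_group W u
    obtain ⟨a, ha, hoa⟩ := (Nat.dvd_prime_pow hr).1 (Dvd.intro _ horb)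
    obtain ⟨b, hb, hsb⟩ := (Nat.dvd_prime_pow hr).1 (Dvd.intro_left _ horb)
    have hab : a + b = w := by
      rw [hoa, hsb, ← pow_add] at horb
      exact Nat.pow_right_injective hr.two_le horb
    have hav : a ≤ padicValNat r (q ^ (m + 1) - 1) := by
      by_contra hlt
      apply hu
      rw [hoa]
      exact pow_dvd_pow _ (by omega)
    let W' : Subgroup (MulAut S) := (MulAction.stabilizer W u).map W.subtype
    have hW' : Nat.card W' = r ^ b := by
      rw [← hsb]
      exact Subgroup.card_map_of_injective W.subtype_injective
    have hle : W' ≤ W := Subgroup.map_subtype_le _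
    have hlt : autFix W < autFix W' := by
      refine lt_of_le_of_ne (fun s hs x hx => hs x (hle hx)) ?_
      intro heq
      have hu1 : (u : S) ∉ autFix W := u.2
      apply hu1
      rw [heq]
      rintro _ ⟨x, hx, rfl⟩
      exact congrArg Subtype.val (MulAction.mem_stabilizer_iff.1 hx)
    obtain ⟨i', hi', hfix'⟩ := (Nat.dvd_prime_pow hq).1 (hS ▸ Subgroup.card_subgroup_dvd_card (autFix W'))
    have hii : i < i' := by
      have h1 : Nat.card (autFix W) < Nat.card (autFix W') := by
        apply Set.ncard_lt_ncard (s := (autFix W : Set S)) (t := (autFix W' : Set S))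
        exact hlt
      rw [hfix, hfix'] at h1
      exact (Nat.pow_lt_pow_iff_right hq.one_lt).1 h1
    have := ih W' b i' hW' hfix' (by omega)
    rw [Finset.sum_Icc_succ_top (by omega)]
    omega

open Nat in
lemma nt_mono (p a b : ℕ) (hp : p.Prime) (h : a ≤ b) :
    padicValNat p (a !) ≤ padicValNat p (b !) := by
  have : Fact p.Prime := ⟨hp⟩
  rw [← padicValNat_dvd_iff_le (Nat.factorial_ne_zero _)]
  exact pow_padicValNat_dvd.trans (Nat.factorial_dvd_factorial h)

open Nat in
lemma nt_legendre (q n k : ℕ) (hq : q.Prime) (hn : 1 ≤ n) (hk : k ≤ padicValNat q (n !)) :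
    (q - 1) * k + 1 ≤ n := by
  have : Fact q.Prime := ⟨hq⟩
  have h := sub_one_mul_padicValNat_factorial (p := q) n
  have h1 : (q - 1) * k ≤ (q - 1) * padicValNat q (n !) := Nat.mul_le_mul_left _ hk
  have h2 : 1 ≤ (Nat.digits q n).sum := by
    by_contra h0
    have h0' : (Nat.digits q n).sum = 0 := by omega
    have h3 := Nat.modEq_digits_sum
    have h4 : ∀ d ∈ Nat.digits q n, d = 0 := by
      intro d hd; exact (List.sum_eq_zero_iff.1 h0') d hd
    have hne : Nat.digits q n ≠ [] := Nat.digits_ne_nil_iff_ne_zero.2 (by omega)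
    exact Nat.getLast_digit_ne_zero q (m := n) (by omega) (h4 _ (List.getLast_mem hne))
  have h3 : (Nat.digits q n).sum ≤ n := Nat.digit_sum_le q n
  omega

open Nat in
lemma nt_fact (p k : ℕ) (hp : p.Prime) :
    padicValNat p (k !) = ∑ j ∈ Finset.Icc 1 k, padicValNat p j := by
  have : Fact p.Prime := ⟨hp⟩
  induction k with
  | zero => simp
  | succ k ih =>
    rw [Finset.sum_Icc_succ_top (by omega), ← ih, Nat.factorial_succ,
      padicValNat.mul (by omega) (Nat.factorial_ne_zero _)]
    omega

open Nat in
theorem nt_ord : orderOf (3 : ZMod 5) = 2 ^ (1 + 1) :=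
  orderOf_eq_prime_pow (p := 2) (n := 1) (by decide) (by decide)

open Nat in
theorem nt_main (q k n : ℕ) (hq : q.Prime) (hq2 : q ≠ 2) (hk : 2 ≤ k) (hn : 5 ≤ n)
    (hkn : k ≤ padicValNat q (n !)) : ∃ r : ℕ, r.Prime ∧ r ≠ 2 ∧ r ≠ q ∧
      ∑ j ∈ Finset.Icc 1 k, padicValNat r (q ^ j - 1) < padicValNat r (n !) := by
  have h3 : Fact (Nat.Prime 3) := ⟨Nat.prime_three⟩
  have h5 : Fact (Nat.Prime 5) := ⟨Nat.prime_five⟩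
  have hleg := nt_legendre q n k hq (by omega) hkn
  by_cases hq3 : q = 3
  · subst hq3
    by_cases hex : k = 4 ∧ n = 9
    · obtain ⟨rfl, rfl⟩ := hex
      have h7 : Fact (Nat.Prime 7) := ⟨by norm_num⟩
      refine ⟨7, by norm_num, by norm_num, by norm_num, ?_⟩
      have e1 : ∑ j ∈ Finset.Icc 1 4, padicValNat 7 (3 ^ j - 1) = 0 := by
        apply Finset.sum_eq_zero
        intro j hj
        have := Finset.mem_Icc.1 hj
        apply padicValNat.eq_zero_of_not_dvd
        obtain ⟨h1, h2⟩ := this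
        interval_cases j <;> norm_num
      rw [e1]
      apply Nat.pos_of_ne_zero
      rw [← dvd_iff_padicValNat_ne_zero (Nat.factorial_ne_zero _)]
      decide
    · refine ⟨5, by norm_num, by norm_num, by norm_num, ?_⟩
      have hsum : ∀ k, ∑ j ∈ Finset.Icc 1 k, padicValNat 5 (3 ^ j - 1)
          = padicValNat 5 ((5 * (k / 4))!) := by
        intro k
        induction k with
        | zero => simp
        | succ k ih =>
          rw [Finset.sum_Icc_succ_top (by omega), ih]
          by_cases h4 : 4 ∣ k + 1
          · obtain ⟨i, hi⟩ := h4
            have e1 : k / 4 = i - 1 := by omega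
            have e2 : (k + 1) / 4 = i := by omega
            have hi0 : i ≠ 0 := by omega
            rw [e1, e2, hi, padicValNat_factorial_mul, padicValNat_factorial_mul, pow_mul]
            have e3 := padicValNat.pow_sub_pow (p := 5) (x := 3 ^ 4) (y := 1) (by norm_num) (by decide)
              (by norm_num) (by norm_num) hi0
            rw [one_pow] at e3
            rw [e3]
            have e4 : padicValNat 5 (3 ^ 4 - 1) = 1 := by
              have : 3 ^ 4 - 1 = 5 * 16 := by norm_num
              rw [this, padicValNat.mul (by norm_num) (by norm_num), padicValNat_self,
                padicValNat.eq_zero_of_not_dvd (by norm_num)]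
            rw [e4]
            obtain ⟨i', rfl⟩ : ∃ i', i = i' + 1 := ⟨i - 1, by omega⟩
            rw [Nat.factorial_succ, padicValNat.mul (by omega) (Nat.factorial_ne_zero _)]
            simp only [Nat.add_sub_cancel]
            omega
          · have e1 : (k + 1) / 4 = k / 4 := by omega
            suffices hz : padicValNat 5 (3 ^ (k + 1) - 1) = 0 by rw [e1, hz, add_zero]
            apply padicValNat.eq_zero_of_not_dvd
            intro h
            apply h4
            have h6 : (3 : ZMod 5) ^ (k + 1) = 1 := by
              have h7 : ((3 ^ (k + 1) - 1 : ℕ) : ZMod 5) = 0 := (ZMod.natCast_eq_zero_iff _ _).2 h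
              rw [Nat.cast_sub (Nat.one_le_pow _ _ (by norm_num))] at h7
              push_cast at h7
              exact sub_eq_zero.1 h7
            have h8 := nt_ord
            have := orderOf_dvd_of_pow_eq_one h6
            rw [h8] at this
            simpa using this
      rw [hsum]
      have hle : 5 * (k / 4 + 1) ≤ n := by
        rcases Nat.lt_or_ge k 4 with h | h
        · omega
        · by_cases hk4 : k = 4
          · have : n ≠ 9 := fun h => hex ⟨hk4, h⟩
            omega
          · omega
      refine lt_of_lt_of_le ?_ (nt_mono 5 _ _ Nat.prime_five hle)
      rw [padicValNat_factorial_mul, padicValNat_factorial_mul]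
      have := nt_mono 5 (k / 4) (k / 4 + 1) Nat.prime_five (by omega)
      omega
  · refine ⟨3, by norm_num, by norm_num, fun h => hq3 h.symm, ?_⟩
    have hq5 : 5 ≤ q := by
      have := hq.two_le
      have h4 : q ≠ 4 := by rintro rfl; revert hq; norm_num
      omega
    have h3q : ¬ 3 ∣ q := fun h => hq3 ((Nat.prime_dvd_prime_iff_eq Nat.prime_three hq).1 h).symm
    have hqodd : q % 2 = 1 := hq.eq_two_or_odd.resolve_left hq2
    set v := padicValNat 3 (q ^ 2 - 1) with hv
    have hfac : q ^ 2 - 1 = (q + 1) * (q - 1) := by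
      have := Nat.sq_sub_sq q 1
      simpa using this
    have hne : q ^ 2 - 1 ≠ 0 := by
      rw [hfac]; apply Nat.mul_ne_zero <;> omega
    have h3d : 3 ∣ q ^ 2 - 1 := by
      rw [hfac]
      have h3 : q % 3 = 1 ∨ q % 3 = 2 := by omega
      have h3' : (q + 1) % 3 = 0 ∨ (q - 1) % 3 = 0 := by
        clear hkn hleg hfac hne hv
        rcases h3 with h3 | h3
        · right; omega
        · left; omega
      rcases h3' with h | h
      · exact Dvd.dvd.mul_right (Nat.dvd_of_mod_eq_zero h) _
      · exact Dvd.dvd.mul_left (Nat.dvd_of_mod_eq_zero h) _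
    have hv1 : 1 ≤ v := one_le_padicValNat_of_dvd hne h3d
    have hvq : 2 * 3 ^ v ≤ q + 1 := by
      have hdv : 3 ^ v ∣ (q + 1) * (q - 1) := by rw [← hfac]; exact pow_padicValNat_dvd
      have hodd : Nat.Coprime 2 (3 ^ v) := Nat.Coprime.pow_right _ (by norm_num)
      rcases (by omega : ¬ 3 ∣ q - 1 ∨ ¬ 3 ∣ q + 1) with h | h
      · have hc : Nat.Coprime (3 ^ v) (q - 1) :=
          Nat.Coprime.pow_left _ ((Nat.Prime.coprime_iff_not_dvd Nat.prime_three).2 h)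
        have h6 := hc.dvd_of_dvd_mul_right hdv
        have h7 : 2 * 3 ^ v ∣ q + 1 := hodd.mul_dvd_of_dvd_of_dvd (by omega) h6
        exact Nat.le_of_dvd (by omega) h7
      · have hc : Nat.Coprime (3 ^ v) (q + 1) :=
          Nat.Coprime.pow_left _ ((Nat.Prime.coprime_iff_not_dvd Nat.prime_three).2 h)
        have h6 := hc.dvd_of_dvd_mul_left hdv
        have h7 : 2 * 3 ^ v ∣ q - 1 := hodd.mul_dvd_of_dvd_of_dvd (by omega) h6
        have := Nat.le_of_dvd (by omega) h7
        omega
    have hsum : ∑ j ∈ Finset.Icc 1 k, padicValNat 3 (q ^ j - 1) ≤ k * v + padicValNat 3 (k !) := by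
      have e1 : ∀ j ∈ Finset.Icc 1 k, padicValNat 3 (q ^ j - 1) ≤ v + padicValNat 3 j := by
        intro j hj
        have hj0 : j ≠ 0 := by have := (Finset.mem_Icc.1 hj).1; omega
        have e3 := padicValNat.pow_sub_pow (p := 3) (x := q ^ 2) (y := 1)
          (by decide) (Nat.one_lt_pow (by norm_num) (by omega)) h3d
          (fun h => h3q (Nat.prime_three.dvd_of_dvd_pow h)) hj0
        rw [one_pow, ← hv] at e3
        rw [← e3]
        have h8 : 1 < q ^ j := Nat.one_lt_pow hj0 (by omega)
        have e4 : (q ^ 2) ^ j - 1 = (q ^ j + 1) * (q ^ j - 1) := by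
          have := Nat.sq_sub_sq (q ^ j) 1
          rw [← pow_mul, mul_comm, pow_mul]
          simpa using this
        rw [← padicValNat_dvd_iff_le (by rw [e4]; apply Nat.mul_ne_zero <;> omega), e4]
        exact Dvd.dvd.mul_left pow_padicValNat_dvd _
      refine (Finset.sum_le_sum e1).trans ?_
      rw [Finset.sum_add_distrib, ← nt_fact 3 k Nat.prime_three]
      simp
    refine lt_of_le_of_lt hsum ?_
    rcases (by omega : v = 1 ∨ 2 ≤ v) with h | h
    · rw [h, mul_one]
      have h9 : 4 * k ≤ (q - 1) * k := Nat.mul_le_mul_right _ (by omega)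
      refine lt_of_lt_of_le ?_ (nt_mono 3 (3 * (k + 1)) _ Nat.prime_three (by omega))
      rw [padicValNat_factorial_mul]
      have := nt_mono 3 k (k + 1) Nat.prime_three (by omega)
      omega
    · have h9 : 3 ^ v * k ≤ (q - 1) * k := by
        apply Nat.mul_le_mul_right
        have : 3 ^ 2 ≤ 3 ^ v := Nat.pow_le_pow_right (by norm_num) h
        omega
      refine lt_of_lt_of_le ?_ (nt_mono 3 (3 ^ v * k) _ Nat.prime_three (by omega))
      have hind : ∀ v, 2 ≤ v → k * v + padicValNat 3 (k !) < padicValNat 3 ((3 ^ v * k)!) := by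
        intro v hv
        induction v, hv using Nat.le_induction with
        | base =>
          have : 3 ^ 2 * k = 3 * (3 * k) := by ring
          rw [this, padicValNat_factorial_mul, padicValNat_factorial_mul]
          omega
        | succ v hv ih =>
          have : 3 ^ (v + 1) * k = 3 * (3 ^ v * k) := by ring
          rw [this, padicValNat_factorial_mul]
          have h1 : 1 * k ≤ 3 ^ v * k := Nat.mul_le_mul_right _ (Nat.one_le_pow _ _ (by norm_num))
          rw [mul_add]
          omega
      exact hind v h


section cov
variable {X A : Type*} [Group X] [Group A]

/-- conjugate subgroup -/
def cj (y : X) (S : Subgroup X) : Subgroup X := S.map (MulAut.conj y).toMonoidHom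

lemma mem_cj (y x : X) (S : Subgroup X) : x ∈ cj y S ↔ y⁻¹ * x * y ∈ S := by
  unfold cj
  rw [Subgroup.mem_map]
  constructor
  · rintro ⟨s, hs, rfl⟩
    simpa [mul_assoc] using hs
  · intro h
    exact ⟨_, h, by simp [mul_assoc]⟩

lemma card_cj (y : X) (S : Subgroup X) : Nat.card (cj y S) = Nat.card S :=
  (Nat.card_congr (S.equivMapOfInjective _ (MulAut.conj y).injective).toEquiv).symm

lemma cj_mul (y z : X) (S : Subgroup X) : cj y (cj z S) = cj (y * z) S := by
  ext x; simp [mem_cj, mul_assoc]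

lemma cj_one (S : Subgroup X) : cj 1 S = S := by
  ext x; simp [mem_cj]

lemma cj_mono (y : X) {S S' : Subgroup X} (h : S ≤ S') : cj y S ≤ cj y S' := by
  intro x; rw [mem_cj, mem_cj]; exact fun hx => h hx

lemma cj_normal (y : X) (S : Subgroup X) [hS : S.Normal] : cj y S = S := by
  ext x; rw [mem_cj]
  constructor
  · intro h; have := hS.conj_mem _ h y; simpa [mul_assoc] using this
  · intro h; have := hS.conj_mem _ h y⁻¹; simpa [mul_assoc] using this

lemma cj_self {y : X} {S : Subgroup X} (hy : y ∈ S) : cj y S = S := by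
  ext x; rw [mem_cj, Subgroup.mul_mem_cancel_right _ hy, Subgroup.mul_mem_cancel_left _ (S.inv_mem hy)]

lemma cj_eq_iff_normalizer (y : X) (S : Subgroup X) : cj y S = S ↔ y ∈ Subgroup.normalizer (S : Set X) := by
  rw [← Subgroup.inv_mem_iff, Subgroup.mem_normalizer_iff]
  constructor
  · intro h x
    have := mem_cj y x S
    rw [h] at this
    simpa using this
  · intro h
    ext x
    rw [mem_cj, h x]; simp

lemma cj_centralizer (y : X) (S : Subgroup X) :
    cj y (Subgroup.centralizer (S : Set X)) = Subgroup.centralizer (cj y S : Set X) := by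
  ext x
  rw [mem_cj, Subgroup.mem_centralizer_iff, Subgroup.mem_centralizer_iff]
  constructor
  · intro h s hs
    have := h _ ((mem_cj y s S).1 hs)
    have h2 : y * (y⁻¹ * s * y * (y⁻¹ * x * y)) * y⁻¹ = y * (y⁻¹ * x * y * (y⁻¹ * s * y)) * y⁻¹ := by
      rw [this]
    simpa [mul_assoc] using h2
  · intro h s hs
    have := h (y * s * y⁻¹) ((mem_cj y _ S).2 (by simpa [mul_assoc] using hs))
    have h2 : y⁻¹ * (y * s * y⁻¹ * x) * y = y⁻¹ * (x * (y * s * y⁻¹)) * y := by rw [this]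
    simpa [mul_assoc] using h2

def Cov (π : X →* A) (H : Subgroup X) : Prop := ∀ a, ∃ x ∈ H, π x = a

lemma Cov.mono {π : X →* A} {H K : Subgroup X} (h : Cov π H) (hk : H ≤ K) : Cov π K := by
  intro a; obtain ⟨x, hx, h2⟩ := h a; exact ⟨x, hk hx, h2⟩

lemma Cov.map {π : X →* A} {H : Subgroup X} (h : Cov π H) : H.map π = ⊤ := by
  rw [eq_top_iff]; intro a _; obtain ⟨x, hx, h2⟩ := h a; exact ⟨x, hx, h2⟩

lemma cov_of_map {π : X →* A} {H : Subgroup X} (h : H.map π = ⊤) : Cov π H := by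
  intro a
  have : a ∈ H.map π := by rw [h]; trivial
  exact this

lemma cov_or (π : X →* A) [IsSimpleGroup A] {H K : Subgroup X} (hH : Cov π H)
    (hK : ∀ h ∈ H, ∀ k ∈ K, h * k * h⁻¹ ∈ K) : Cov π K ∨ K ≤ π.ker := by
  have hn : (K.map π).Normal := by
    constructor
    rintro _ ⟨k, hk, rfl⟩ a
    obtain ⟨h, hh, rfl⟩ := hH a
    exact ⟨h * k * h⁻¹, hK h hh k hk, by simp⟩
  rcases hn.eq_bot_or_eq_top with h | h
  · right; exact (Subgroup.map_eq_bot_iff K).1 h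
  · left; exact cov_of_map h

lemma cov_comm (π : X →* A) (hA : commutator A = ⊤) {H : Subgroup X} (hH : Cov π H) :
    Cov π ⁅H, H⁆ := by
  apply cov_of_map
  rw [Subgroup.map_commutator, hH.map]
  exact hA

/-- S is a Sylow q-subgroup of Y -/
def SylIn (q : ℕ) (S Y : Subgroup X) : Prop :=
  S ≤ Y ∧ Nat.card S = q ^ (Nat.card Y).factorization q

lemma card_pgroup_le [Finite X] {q : ℕ} (hq : q.Prime) {Q Y : Subgroup X} {k : ℕ} (hQ : Nat.card Q = q ^ k)
    (h : Q ≤ Y) : k ≤ (Nat.card Y).factorization q := by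
  have h1 := Subgroup.card_dvd_of_le h
  rw [hQ] at h1
  exact (hq.pow_dvd_iff_le_factorization Nat.card_pos.ne').1 h1

lemma syl_exists_ge [Finite X] {q : ℕ} (hq : q.Prime) {Q Y : Subgroup X} {k : ℕ} (hQ : Nat.card Q = q ^ k)
    (h : Q ≤ Y) : ∃ S, SylIn q S Y ∧ Q ≤ S := by
  have : Fact q.Prime := ⟨hq⟩
  have hQ' : IsPGroup q (Q.subgroupOf Y) := by
    apply IsPGroup.of_card (n := k)
    rw [← hQ]
    exact Nat.card_congr (Subgroup.subgroupOfEquivOfLe h).toEquiv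
  obtain ⟨S, hS⟩ := hQ'.exists_le_sylow
  refine ⟨(S : Subgroup Y).map Y.subtype, ⟨Subgroup.map_subtype_le _, ?_⟩, ?_⟩
  · rw [← S.card_eq_multiplicity]
    exact (Nat.card_congr (Subgroup.equivMapOfInjective _ _ Y.subtype_injective).toEquiv).symm
  · intro x hx
    exact ⟨⟨x, h hx⟩, hS (by simpa [Subgroup.mem_subgroupOf] using hx), rfl⟩

lemma syl_exists [Finite X] {q : ℕ} (hq : q.Prime) (Y : Subgroup X) : ∃ S, SylIn q S Y := by
  obtain ⟨S, hS, _⟩ := syl_exists_ge hq (Q := ⊥) (Y := Y) (k := 0) (by simp) bot_le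
  exact ⟨S, hS⟩

lemma syl_conj [Finite X] {q : ℕ} (hq : q.Prime) {S S' Y : Subgroup X} (h : SylIn q S Y) (h' : SylIn q S' Y) :
    ∃ y ∈ Y, cj y S = S' := by
  have : Fact q.Prime := ⟨hq⟩
  have e : ∀ S, SylIn q S Y → Nat.card (S.subgroupOf Y) = q ^ (Nat.card Y).factorization q := by
    intro S h
    rw [← h.2]
    exact Nat.card_congr (Subgroup.subgroupOfEquivOfLe h.1).toEquiv
  let P : Sylow q Y := Sylow.ofCard (S.subgroupOf Y) (e S h)
  let P' : Sylow q Y := Sylow.ofCard (S'.subgroupOf Y) (e S' h')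
  obtain ⟨y, hy⟩ := MulAction.exists_smul_eq Y P P'
  refine ⟨y, y.2, ?_⟩
  have hy2 : ∀ x : Y, x ∈ P' ↔ y⁻¹ * x * y ∈ P := by
    intro x
    rw [← hy, ← SetLike.mem_coe, Sylow.coe_smul, Set.mem_smul_set_iff_inv_smul_mem, ← map_inv, MulAut.smul_def]
    simp
  have hP : ∀ x, x ∈ P ↔ (x : X) ∈ S := fun x => Subgroup.mem_subgroupOf
  have hP' : ∀ x, x ∈ P' ↔ (x : X) ∈ S' := fun x => Subgroup.mem_subgroupOf
  ext x
  rw [mem_cj]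
  constructor
  · intro hx
    have hxY : x ∈ Y := by
      have := Y.mul_mem (Y.mul_mem y.2 (h.1 hx)) (Y.inv_mem y.2)
      simpa [mul_assoc] using this
    have := (hy2 ⟨x, hxY⟩)
    rw [hP, hP'] at this
    exact this.2 hx
  · intro hx
    have := (hy2 ⟨x, h'.1 hx⟩)
    rw [hP, hP'] at this
    exact this.1 hx

lemma SylIn.of_le [Finite X] {q : ℕ} (hq : q.Prime) {S Y Z : Subgroup X} (h : SylIn q S Y) (hZ : Z ≤ Y) (hS : S ≤ Z) :
    SylIn q S Z := by
  refine ⟨hS, ?_⟩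
  rw [h.2]
  congr 1
  apply le_antisymm
  · exact card_pgroup_le hq h.2 hS
  · exact (Nat.factorization_le_iff_dvd Nat.card_pos.ne' Nat.card_pos.ne').2 (Subgroup.card_dvd_of_le hZ) q

lemma SylIn.cj {q : ℕ} {S Y : Subgroup X} (h : SylIn q S Y) (y : X) : SylIn q (cj y S) (cj y Y) := by
  refine ⟨cj_mono y h.1, ?_⟩
  rw [card_cj, card_cj, h.2]

lemma syl_frattini [Finite X] (π : X →* A) {q : ℕ} (hq : q.Prime) {H S : Subgroup X} (hH : Cov π H)
    (hS : SylIn q S (H ⊓ π.ker)) : Cov π (H ⊓ Subgroup.normalizer (S : Set X)) := by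
  intro a
  obtain ⟨x, hx, rfl⟩ := hH a
  have h1 : cj x (H ⊓ π.ker) = H ⊓ π.ker := by
    ext z
    have e1 := SetLike.ext_iff.1 (cj_self hx) z
    have e2 := SetLike.ext_iff.1 (cj_normal x π.ker) z
    rw [mem_cj] at e1 e2 ⊢
    rw [Subgroup.mem_inf, Subgroup.mem_inf, e1, e2]
  have h2 := hS.cj x
  rw [h1] at h2
  obtain ⟨y, hy, h3⟩ := syl_conj hq h2 hS
  rw [cj_mul, cj_eq_iff_normalizer] at h3
  refine ⟨y * x, ⟨H.mul_mem hy.1 hx, h3⟩, ?_⟩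
  rw [map_mul, hy.2, one_mul]

lemma card_cov [Finite X] (π : X →* A) {H : Subgroup X} (hH : Cov π H) :
    Nat.card H = Nat.card A * Nat.card (H ⊓ π.ker : Subgroup X) := by
  have h1 := Subgroup.card_eq_card_quotient_mul_card_subgroup (π.comp H.subtype).ker
  have hs : Function.Surjective (π.comp H.subtype) := by
    intro a; obtain ⟨x, hx, h⟩ := hH a; exact ⟨⟨x, hx⟩, h⟩
  rw [Nat.card_congr (QuotientGroup.quotientKerEquivOfSurjective _ hs).toEquiv] at h1
  rw [h1]
  congr 1
  have h2 : (π.comp H.subtype).ker = (H ⊓ π.ker).subgroupOf H := by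
    ext x; simp [Subgroup.mem_subgroupOf, MonoidHom.mem_ker]
  rw [h2]
  exact Nat.card_congr (Subgroup.subgroupOfEquivOfLe inf_le_left).toEquiv

lemma fact_cov [Finite X] (π : X →* A) {H : Subgroup X} (hH : Cov π H) (q : ℕ) :
    (Nat.card H).factorization q = (Nat.card A).factorization q
      + (Nat.card (H ⊓ π.ker : Subgroup X)).factorization q := by
  have hA : Finite A := Finite.of_surjective π (fun a => by obtain ⟨x, _, h⟩ := hH a; exact ⟨x, h⟩)
  rw [card_cov π hH, Nat.factorization_mul Nat.card_pos.ne' Nat.card_pos.ne']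
  rfl

lemma cyclic_comm {R : Subgroup X} [IsCyclic R] :
    ⁅Subgroup.normalizer (R : Set X), Subgroup.normalizer (R : Set X)⁆ ≤ Subgroup.centralizer (R : Set X) := by
  rw [Subgroup.commutator_le]
  intro x hx y hy
  have h1 : ∀ a b : MulAut R, a * b = b * a := by
    intro a b
    obtain ⟨m, hm⟩ := MonoidHom.map_cyclic (a : R →* R)
    obtain ⟨k, hk⟩ := MonoidHom.map_cyclic (b : R →* R)
    ext1 z
    simp only [MonoidHom.coe_coe] at hm hk
    rw [MulAut.mul_apply, MulAut.mul_apply, hm, hk, hm, hk, ← zpow_mul, ← zpow_mul, mul_comm]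
  let x' : Subgroup.normalizer (R : Set X) := ⟨x, hx⟩
  let y' : Subgroup.normalizer (R : Set X) := ⟨y, hy⟩
  have h2 : x' * y' * x'⁻¹ * y'⁻¹ ∈ (R.normalizerMonoidHom).ker := by
    rw [MonoidHom.mem_ker, map_mul, map_mul, map_mul, h1 (R.normalizerMonoidHom x'), map_inv, map_inv]
    group
  rw [Subgroup.normalizerMonoidHom_ker] at h2
  exact h2

end cov


section cov2
variable {X A : Type*} [Group X] [Group A]

lemma cov_top (π : X →* A) (hπ : Function.Surjective π) : Cov π ⊤ := by
  intro a; obtain ⟨x, hx⟩ := hπ a; exact ⟨x, trivial, hx⟩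

lemma centralizer_normalized (S : Subgroup X) :
    ∀ h ∈ Subgroup.normalizer (S : Set X), ∀ k ∈ Subgroup.centralizer (S : Set X),
      h * k * h⁻¹ ∈ Subgroup.centralizer (S : Set X) := by
  intro h hh k hk
  rw [← cj_eq_iff_normalizer] at hh
  have := cj_centralizer h S
  rw [hh] at this
  rw [← this, mem_cj]
  simpa [mul_assoc] using hk

lemma cov_normalizer [Finite X] (π : X →* A) (hπ : Function.Surjective π) {q : ℕ} (hq : q.Prime)
    {S : Subgroup X} (hS : SylIn q S π.ker) : Cov π (Subgroup.normalizer (S : Set X)) := by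
  have := syl_frattini π hq (cov_top π hπ) (S := S) (by rwa [top_inf_eq])
  rwa [top_inf_eq] at this

theorem cov_centralizer [Finite X] [IsSimpleGroup A] (hA : commutator A = ⊤) (n : ℕ) (hn : 5 ≤ n)
    (hcA : 2 * Nat.card A = n.factorial) (π : X →* A) (hπ : Function.Surjective π)
    (hT : Nat.card π.ker ∣ n.factorial) {q : ℕ} (hq : q.Prime) (hq2 : q ≠ 2) {S : Subgroup X}
    (hS : SylIn q S π.ker) : Cov π (Subgroup.centralizer (S : Set X)) := by
  have hN := cov_normalizer π hπ hq hS
  have hq' : Fact q.Prime := ⟨hq⟩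
  rcases cov_or π hN (centralizer_normalized S) with h | hle
  · exact h
  exfalso
  have hnf : n.factorial ≠ 0 := Nat.factorial_ne_zero _
  set k := (Nat.card π.ker).factorization q with hk
  have hkn : k ≤ padicValNat q n.factorial := by
    have := (Nat.factorization_le_iff_dvd Nat.card_pos.ne' hnf).2 hT q
    rwa [Nat.factorization_def n.factorial hq] at this
  rcases Nat.lt_or_ge k 2 with hk2 | hk2
  · have hcyc : IsCyclic S := by
      have h3 := hS.2
      rw [← hk] at h3
      rcases (by omega : k = 0 ∨ k = 1) with h | h
      · rw [h, pow_zero] at h3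
        have : Subsingleton S := (Nat.card_eq_one_iff_unique.1 h3).1
        infer_instance
      · rw [h, pow_one] at h3
        exact isCyclic_of_prime_card h3
    have h4 := (cov_comm π hA hN).mono cyclic_comm
    have : Nontrivial A := inferInstance
    obtain ⟨a, ha⟩ := exists_ne (1 : A)
    obtain ⟨x, hx, hxa⟩ := h4 a
    exact ha (hxa ▸ hle hx)
  · obtain ⟨r, hr, hr2, hrq, hlt⟩ := nt_main q k n hq hq2 hk2 hn hkn
    have hr' : Fact r.Prime := ⟨hr⟩
    obtain ⟨W, hW⟩ := syl_exists hr (Subgroup.normalizer (S : Set X))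
    set Nz := Subgroup.normalizer (S : Set X) with hNz
    have hvr : (Nat.card A).factorization r = padicValNat r n.factorial := by
      have hA0 : Nat.card A ≠ 0 := by intro h; rw [h] at hcA; omega
      rw [← Nat.factorization_def _ hr, ← hcA, Nat.factorization_mul (by norm_num) hA0,
        Finsupp.add_apply, Nat.prime_two.factorization, Finsupp.single_eq_of_ne hr2, zero_add]
    have hf := fact_cov π hN r
    let θ : W →* MulAut S := (S.normalizerMonoidHom).comp (Subgroup.inclusion hW.1)
    have hker : Nat.card θ.ker ≤ Nat.card (W ⊓ π.ker : Subgroup X) := by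
      refine Nat.card_le_card_of_injective
        (fun x => (⟨x.1.1, x.1.2, ?_⟩ : (W ⊓ π.ker : Subgroup X))) ?_
      · apply hle
        have hx : (Subgroup.inclusion hW.1 x.1) ∈ (S.normalizerMonoidHom).ker := x.2
        rw [Subgroup.normalizerMonoidHom_ker] at hx
        exact hx
      · intro x y hxy
        exact Subtype.ext (Subtype.ext (congrArg (fun z : (W ⊓ π.ker : Subgroup X) => (z : X)) hxy))
    obtain ⟨i, hi⟩ :=       (IsPGroup.iff_card (p := r) (G := (W ⊓ π.ker : Subgroup X))).1
        ((IsPGroup.of_card hW.2).to_le inf_le_left)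
    have hi2 : i ≤ (Nat.card (Nz ⊓ π.ker : Subgroup X)).factorization r :=
      card_pgroup_le hr hi (inf_le_inf_right _ hW.1)
    have hcW : Nat.card W = Nat.card θ.range * Nat.card θ.ker := by
      rw [Subgroup.card_eq_card_quotient_mul_card_subgroup θ.ker,
        Nat.card_congr (QuotientGroup.quotientKerEquivRange θ).toEquiv]
    have hpr : IsPGroup r θ.range := (IsPGroup.of_card hW.2).of_surjective θ.rangeRestrict
      θ.rangeRestrict_surjective
    have hfinA : Finite (MulAut S) :=
      Finite.of_injective (fun e : MulAut S => (e : S → S)) DFunLike.coe_injective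
    obtain ⟨w, hw⟩ := IsPGroup.iff_card.1 hpr
    have hge : padicValNat r n.factorial ≤ w := by
      have h1 : r ^ (Nat.card Nz).factorization r ≤ r ^ w * r ^ i := by
        rw [← hW.2, hcW, hw, ← hi]
        exact Nat.mul_le_mul_left _ hker
      rw [← pow_add] at h1
      have := (Nat.pow_le_pow_iff_right hr.one_lt).1 h1
      omega
    obtain ⟨i', hi'⟩ := IsPGroup.iff_card.1 ((IsPGroup.of_card hS.2).to_subgroup (autFix θ.range))
    have := autL1 q r k hq hr (Ne.symm hrq) hS.2 k θ.range w i' hw hi' (by omega)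
    omega
end cov2


open scoped IsMulCommutative in
lemma central_comm_trivial {F : Type*} [Group F] [Finite F] {p : ℕ} (hp : p.Prime)
    (hv : (Nat.card F).factorization p ≤ 2) (z : F) (hz : z ∈ Subgroup.center F)
    (hc : z ∈ commutator F) (hzp : z ^ p = 1) : z = 1 := by
  have : Fact p.Prime := ⟨hp⟩
  obtain ⟨P⟩ : Nonempty (Sylow p F) := inferInstance
  have hcard := P.card_eq_multiplicity
  have hPc : IsMulCommutative (P : Subgroup F) := by
    rcases (by omega : (Nat.card F).factorization p = 0 ∨ (Nat.card F).factorization p = 1 ∨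
      (Nat.card F).factorization p = 2) with h | h | h
    · rw [h, pow_zero] at hcard
      have : Subsingleton P := (Nat.card_eq_one_iff_unique.1 hcard).1
      exact ⟨⟨fun a b => Subsingleton.elim _ _⟩⟩
    · rw [h, pow_one] at hcard
      have : IsCyclic P := isCyclic_of_prime_card hcard
      infer_instance
    · rw [h] at hcard
      exact ⟨⟨fun a b => (IsPGroup.commGroupOfCardEqPrimeSq hcard).mul_comm a b⟩⟩
  have key : ∀ (k : ℕ) (g₀ : F), g₀⁻¹ * z ^ k * g₀ ∈ (P : Subgroup F) → g₀⁻¹ * z ^ k * g₀ = z ^ k := by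
    intro k g₀ _
    have h := Subgroup.mem_center_iff.1 (Subgroup.pow_mem _ hz k) g₀
    rw [mul_assoc, ← h]; simp
  have h1 := MonoidHom.transfer_eq_pow (MonoidHom.id (P : Subgroup F)) z key
  have h2 : MonoidHom.transfer (MonoidHom.id (P : Subgroup F)) z = 1 := by
    have := Abelianization.commutator_subset_ker (MonoidHom.transfer (MonoidHom.id (P : Subgroup F)))
    exact this hc
  rw [h2] at h1
  have h3 : z ^ (P : Subgroup F).index = 1 := (congrArg Subtype.val h1).symm
  have h4 := orderOf_dvd_of_pow_eq_one h3
  have h5 := orderOf_dvd_of_pow_eq_one hzp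
  have h6 : Nat.Coprime p (P : Subgroup F).index := (Nat.Prime.coprime_iff_not_dvd hp).2 P.not_dvd_index
  exact orderOf_eq_one_iff.1 (Nat.eq_one_of_dvd_coprimes h6 h5 h4)

lemma burn {K : Type*} [Group K] [Finite K] {p q : ℕ} (hp : p.Prime) (hq : q.Prime) (hpq : p ≠ q)
    {R S : Subgroup K} (hv : (Nat.card K).factorization p = 1) (hR : Nat.card R = p)
    (hN : Subgroup.normalizer (R : Set K) ≤ Subgroup.centralizer (R : Set K))
    (hS : SylIn q S ⊤) : ∃ R1 : Subgroup K, Nat.card R1 = p ∧ R1 ≤ Subgroup.normalizer (S : Set K) := by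
  have : Fact p.Prime := ⟨hp⟩
  let P : Sylow p K := Sylow.ofCard R (by rw [hv, pow_one, hR])
  have hP : Subgroup.normalizer P ≤ Subgroup.centralizer (P : Set K) := hN
  let ψ := MonoidHom.transferSylow P hP
  have hk : ¬ p ∣ Nat.card ψ.ker := MonoidHom.not_dvd_card_ker_transferSylow P hP
  have hcK : Nat.card K = Nat.card ψ.range * Nat.card ψ.ker := by
    rw [Subgroup.card_eq_card_quotient_mul_card_subgroup ψ.ker,
      Nat.card_congr (QuotientGroup.quotientKerEquivRange ψ).toEquiv]
  have hpr : p ∣ Nat.card ψ.range := by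
    have h1 : p ∣ Nat.card K := hR ▸ Subgroup.card_subgroup_dvd_card R
    rw [hcK] at h1
    exact (hp.dvd_mul.1 h1).resolve_right hk
  have hSk : S ≤ ψ.ker := by
    intro s hs
    rw [MonoidHom.mem_ker, ← orderOf_eq_one_iff]
    have h1 : orderOf (ψ s) ∣ p := by
      have h2 : Nat.card P = p := hR
      exact (orderOf_dvd_natCard (ψ s)).trans (dvd_of_eq h2)
    have h2 : orderOf (ψ s) ∣ q ^ (Nat.card (⊤ : Subgroup K)).factorization q := by
      refine (orderOf_map_dvd ψ s).trans ?_
      rw [← hS.2, ← Subgroup.orderOf_mk s hs]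
      exact orderOf_dvd_natCard _
    exact Nat.eq_one_of_dvd_coprimes (((Nat.coprime_primes hp hq).2 hpq).pow_right _) h1 h2
  have hS' : SylIn q S ψ.rangeRestrict.ker := by
    rw [MonoidHom.ker_rangeRestrict]
    exact hS.of_le hq le_top hSk
  have h1 := card_cov _ (cov_normalizer ψ.rangeRestrict ψ.rangeRestrict_surjective hq hS')
  have h2 : p ∣ Nat.card (Subgroup.normalizer (S : Set K)) := h1 ▸ hpr.mul_right _
  obtain ⟨x, hx⟩ := exists_prime_orderOf_dvd_card' p h2
  refine ⟨Subgroup.zpowers (x : K), ?_, ?_⟩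
  · rw [Nat.card_zpowers, Subgroup.orderOf_coe, hx]
  · rw [Subgroup.zpowers_le]; exact x.2


section cov4
variable {X A : Type*} [Group X] [Group A]

lemma cyclic_of_syl [Finite X] {p : ℕ} (hp : p.Prime) {R Y : Subgroup X} (hR : SylIn p R Y)
    (hv : (Nat.card Y).factorization p ≤ 1) : IsCyclic R := by
  have : Fact p.Prime := ⟨hp⟩
  have h3 := hR.2
  rcases (by omega : (Nat.card Y).factorization p = 0 ∨ (Nat.card Y).factorization p = 1) with h | h
  · rw [h, pow_zero] at h3
    have : Subsingleton R := (Nat.card_eq_one_iff_unique.1 h3).1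
    infer_instance
  · rw [h, pow_one] at h3
    exact isCyclic_of_prime_card h3

lemma fact_le_of_le [Finite X] {Y Z : Subgroup X} (h : Y ≤ Z) (p : ℕ) :
    (Nat.card Y).factorization p ≤ (Nat.card Z).factorization p :=
  (Nat.factorization_le_iff_dvd Nat.card_pos.ne' Nat.card_pos.ne').2 (Subgroup.card_dvd_of_le h) p

lemma le_centralizer_of_cyclic {R : Subgroup X} [IsCyclic R] : R ≤ Subgroup.centralizer (R : Set X) := by
  intro x hx
  rw [Subgroup.mem_centralizer_iff]
  intro y hy
  have := IsCyclic.commGroup (α := R) |>.mul_comm ⟨y, hy⟩ ⟨x, hx⟩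
  exact congrArg Subtype.val this

lemma centralizer_le_normalizer' (R : Subgroup X) :
    Subgroup.centralizer (R : Set X) ≤ Subgroup.normalizer (R : Set X) := by
  intro x hx
  rw [Subgroup.mem_centralizer_iff] at hx
  rw [← cj_eq_iff_normalizer]
  ext z
  rw [mem_cj]
  constructor
  · intro h
    have h2 := hx _ h
    have h3 : z = x⁻¹ * z * x := by
      have : x * (x⁻¹ * z * x) * x⁻¹ = x⁻¹ * z * x := by rw [← h2]; group
      rw [← this]; group
    rw [h3]; exact h
  · intro h
    rw [mul_assoc, hx z h]; simpa using h

lemma R_inf_comm [Finite X] (π : X →* A) {p : ℕ} (hp : p.Prime)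
    (hvA : (Nat.card A).factorization p = 1) (hvT : (Nat.card π.ker).factorization p ≤ 1)
    {R : Subgroup X} (hR : SylIn p R π.ker) (hF : Cov π (Subgroup.centralizer (R : Set X))) :
    ∀ z ∈ R, z ∈ ⁅Subgroup.centralizer (R : Set X), Subgroup.centralizer (R : Set X)⁆ → z = 1 := by
  intro z hz hzF
  set F := Subgroup.centralizer (R : Set X) with hFd
  rw [← Subgroup.map_subtype_commutator] at hzF
  obtain ⟨w, hw, rfl⟩ := hzF
  have h1 : (Nat.card F).factorization p ≤ 2 := by
    rw [fact_cov π hF, hvA]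
    have := fact_le_of_le (inf_le_right : F ⊓ π.ker ≤ π.ker) p
    omega
  have := central_comm_trivial hp h1 w ?_ hw ?_
  · rw [this]; rfl
  · rw [Subgroup.mem_center_iff]
    intro g
    have h2 := Subgroup.mem_centralizer_iff.1 (show (g : X) ∈ Subgroup.centralizer (R : Set X) from g.2)
    exact Subtype.ext (h2 _ hz).symm
  · apply Subtype.ext
    have h3 : (⟨F.subtype w, hz⟩ : R) ^ p = 1 := by
      rw [← orderOf_dvd_iff_pow_eq_one]
      refine (orderOf_dvd_natCard _).trans ?_
      rw [hR.2]
      exact (pow_dvd_pow p hvT).trans (dvd_of_eq (pow_one p))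
    simpa using congrArg Subtype.val h3

lemma fact_F' [Finite X] (π : X →* A) (hA : commutator A = ⊤) {p : ℕ} (hp : p.Prime)
    (hvA : (Nat.card A).factorization p = 1) (hvT : (Nat.card π.ker).factorization p ≤ 1)
    {R : Subgroup X} (hR : SylIn p R π.ker) (hF : Cov π (Subgroup.centralizer (R : Set X))) :
    (Nat.card (⁅Subgroup.centralizer (R : Set X), Subgroup.centralizer (R : Set X)⁆ :
      Subgroup X)).factorization p = 1 := by
  have hRF := R_inf_comm π hp hvA hvT hR hF
  have hcyc := cyclic_of_syl hp hR hvT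
  have hRR := le_centralizer_of_cyclic (R := R)
  rw [fact_cov π (cov_comm π hA hF), hvA]
  set F := Subgroup.centralizer (R : Set X) with hFd
  have hF'F : ⁅F, F⁆ ≤ F := Subgroup.commutator_le_self F
  obtain ⟨Q, hQ⟩ := syl_exists hp (⁅F, F⁆ ⊓ π.ker)
  obtain ⟨Q', hQ', hQQ'⟩ := syl_exists_ge hp hQ.2 (hQ.1.trans (inf_le_inf_right π.ker hF'F))
  have hR' : SylIn p R (F ⊓ π.ker) := hR.of_le hp inf_le_right (le_inf hRR hR.1)
  obtain ⟨y, hy, h⟩ := syl_conj hp hR' hQ'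
  rw [(cj_eq_iff_normalizer y R).2 (centralizer_le_normalizer' R hy.1)] at h
  have hQb : Q = ⊥ := by
    rw [eq_bot_iff]
    intro z hz
    exact hRF z (h ▸ hQQ' hz) (hQ.1 hz).1
  have h5 := hQ.2
  rw [hQb, Subgroup.card_bot] at h5
  have := (Nat.pow_eq_one.1 h5.symm).resolve_left hp.one_lt.ne'
  omega

lemma claim1 [Finite X] (π : X →* A) (hA : commutator A = ⊤) {p : ℕ} (hp : p.Prime)
    (hvA : (Nat.card A).factorization p = 1) (hvT : (Nat.card π.ker).factorization p ≤ 1)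
    {R : Subgroup X} (hR : SylIn p R π.ker) (hF : Cov π (Subgroup.centralizer (R : Set X)))
    {D : Subgroup X}
    (hD : SylIn p D ⁅Subgroup.centralizer (R : Set X), Subgroup.centralizer (R : Set X)⁆)
    {S : Subgroup X} (hC : Cov π (Subgroup.centralizer (S : Set X)))
    (hRS : R ≤ Subgroup.normalizer (S : Set X)) :
    ∃ y : X, cj y D ≤ Subgroup.centralizer (S : Set X) := by
  have hF' := fact_F' π hA hp hvA hvT hR hF
  have hcyc := cyclic_of_syl hp hR hvT
  let Nz := Subgroup.normalizer (S : Set X)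
  let θ : Nz →* MulAut S := S.normalizerMonoidHom
  let L : Subgroup X := (((R.subgroupOf Nz).map θ).comap θ).map Nz.subtype
  have hRL : R ≤ L := by
    intro x hx
    exact ⟨⟨x, hRS hx⟩, ⟨⟨x, hRS hx⟩, hx, rfl⟩, rfl⟩
  have hCL : Subgroup.centralizer (S : Set X) ≤ L := by
    intro x hx
    refine ⟨⟨x, centralizer_le_normalizer' S hx⟩, ?_, rfl⟩
    change θ _ ∈ (R.subgroupOf Nz).map θ
    have : (⟨x, centralizer_le_normalizer' S hx⟩ : Nz) ∈ θ.ker := by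
      rw [Subgroup.normalizerMonoidHom_ker]; exact hx
    rw [MonoidHom.mem_ker.1 this]
    exact one_mem _
  have hLC : ⁅L, L⁆ ≤ Subgroup.centralizer (S : Set X) := by
    rw [Subgroup.commutator_le]
    rintro _ ⟨x, ⟨r, hr, hxr⟩, rfl⟩ _ ⟨y, ⟨s, hs, hys⟩, rfl⟩
    have hrs : r * s = s * r := by
      apply Subtype.ext
      have := IsCyclic.commGroup (α := R) |>.mul_comm ⟨r, hr⟩ ⟨s, hs⟩
      exact congrArg (fun z : R => (z : X)) this
    have h2 : x * y * x⁻¹ * y⁻¹ ∈ θ.ker := by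
      rw [MonoidHom.mem_ker, map_mul, map_mul, map_mul, map_inv, map_inv, ← hxr, ← hys, ← map_mul, hrs,
        map_mul]
      group
    rw [Subgroup.normalizerMonoidHom_ker] at h2
    exact h2
  have hLcov : Cov π L := hC.mono hCL
  have hNL := syl_frattini π hp hLcov (hR.of_le hp inf_le_right (le_inf hRL hR.1))
  set NL := L ⊓ Subgroup.normalizer (R : Set X) with hNLd
  have hJ := cov_comm π hA hNL
  have hJF : ⁅NL, NL⁆ ≤ Subgroup.centralizer (R : Set X) :=
    (Subgroup.commutator_mono inf_le_right inf_le_right).trans cyclic_comm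
  have hJC : ⁅NL, NL⁆ ≤ Subgroup.centralizer (S : Set X) :=
    (Subgroup.commutator_mono inf_le_left inf_le_left).trans hLC
  have hE := cov_comm π hA hJ
  set E := ⁅⁅NL, NL⁆, ⁅NL, NL⁆⁆ with hEd
  have hEF : E ≤ ⁅Subgroup.centralizer (R : Set X), Subgroup.centralizer (R : Set X)⁆ :=
    Subgroup.commutator_mono hJF hJF
  have hEC : E ≤ Subgroup.centralizer (S : Set X) := (Subgroup.commutator_le_self _).trans hJC
  obtain ⟨D1, hD1⟩ := syl_exists hp E
  have hvE : (Nat.card E).factorization p = 1 := by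
    have h1 := fact_cov π hE p
    have h2 := fact_le_of_le hEF p
    omega
  have hD1' : SylIn p D1 ⁅Subgroup.centralizer (R : Set X), Subgroup.centralizer (R : Set X)⁆ := by
    refine ⟨hD1.1.trans hEF, ?_⟩
    rw [hD1.2, hvE, hF']
  obtain ⟨y, hy, h⟩ := syl_conj hp hD hD1'
  exact ⟨y, h ▸ (hD1.1.trans hEC)⟩
end cov4


section cov5
variable {X A : Type*} [Group X] [Group A]

lemma prime_le {p : ℕ} (hp : p.Prime) {R H : Subgroup X} (hR : Nat.card R = p) {z : X}
    (hz : z ∈ R) (hz1 : z ≠ 1) (hzH : z ∈ H) : R ≤ H := by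
  have : Fact p.Prime := ⟨hp⟩
  have : Fact (Nat.card R).Prime := ⟨hR ▸ hp⟩
  rcases (H.subgroupOf R).eq_bot_or_eq_top_of_prime_card with h | h
  · exfalso
    have : (⟨z, hz⟩ : R) ∈ H.subgroupOf R := hzH
    rw [h, Subgroup.mem_bot] at this
    exact hz1 (congrArg Subtype.val this)
  · exact Subgroup.subgroupOf_eq_top.1 h

lemma card_map' (π : X →* A) (P : Subgroup X) :
    Nat.card P = Nat.card (P.map π) * Nat.card (P ⊓ π.ker : Subgroup X) := by
  have h1 := Subgroup.card_eq_card_quotient_mul_card_subgroup (π.comp P.subtype).ker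
  rw [Nat.card_congr (QuotientGroup.quotientKerEquivRange _).toEquiv] at h1
  rw [h1]
  have h2 : (π.comp P.subtype).ker = (P ⊓ π.ker).subgroupOf P := by
    ext x; simp [Subgroup.mem_subgroupOf, MonoidHom.mem_ker]
  have h3 : (π.comp P.subtype).range = P.map π := by
    rw [MonoidHom.range_comp, Subgroup.range_subtype]
  rw [h2, h3]
  congr 1
  exact Nat.card_congr (Subgroup.subgroupOfEquivOfLe inf_le_left).toEquiv

lemma cj_commutator (y : X) (F : Subgroup X) : cj y ⁅F, F⁆ = ⁅cj y F, cj y F⁆ := by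
  unfold cj; rw [Subgroup.map_commutator]

lemma claim2 [Finite X] (π : X →* A) (hπ : Function.Surjective π) (hA : commutator A = ⊤) {p : ℕ} (hp : p.Prime)
    (hvA : (Nat.card A).factorization p = 1) (hvT : (Nat.card π.ker).factorization p = 1)
    {R : Subgroup X} (hR : SylIn p R π.ker) (hF : Cov π (Subgroup.centralizer (R : Set X)))
    {D : Subgroup X}
    (hD : SylIn p D ⁅Subgroup.centralizer (R : Set X), Subgroup.centralizer (R : Set X)⁆)
    {q : ℕ} (hq : q.Prime) (hqp : q ≠ p)
    (hB : ∀ S, SylIn q S π.ker → Cov π (Subgroup.centralizer (S : Set X))) :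
    ∃ (S : Subgroup X) (y : X), SylIn q S π.ker ∧ cj y D ≤ Subgroup.centralizer (S : Set X) := by
  have hpf : Fact p.Prime := ⟨hp⟩
  have hRc : Nat.card R = p := by rw [hR.2, hvT, pow_one]
  have hcyc := cyclic_of_syl hp hR hvT.le
  have hvtop : (Nat.card (⊤ : Subgroup X)).factorization p = 2 := by
    rw [fact_cov π (cov_top π hπ), top_inf_eq, hvA, hvT]
  -- x, P, S
  obtain ⟨P, hP, hRP⟩ := syl_exists_ge hp hR.2 (le_top : R ≤ ⊤)
  obtain ⟨S, x, hS, hxS, hxP, hxT⟩ : ∃ (S : Subgroup X) (x : X), SylIn q S π.ker ∧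
      x ∈ Subgroup.centralizer (S : Set X) ∧ x ∈ P ∧ x ∉ π.ker := by
    obtain ⟨S0, hS0⟩ := syl_exists hq π.ker
    obtain ⟨Q, hQ⟩ := syl_exists hp (Subgroup.centralizer (S0 : Set X))
    have hnQ : ¬ Q ≤ π.ker := by
      intro h
      have h1 := card_pgroup_le hp hQ.2 (le_inf hQ.1 h)
      have h2 := fact_cov π (hB S0 hS0) p
      omega
    obtain ⟨x, hxQ, hx⟩ := SetLike.not_le_iff_exists.1 hnQ
    obtain ⟨P0, hP0, hQP0⟩ := syl_exists_ge hp hQ.2 (le_top : Q ≤ ⊤)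
    obtain ⟨y, _, hy⟩ := syl_conj hp hP0 hP
    refine ⟨cj y S0, y * x * y⁻¹, ?_, ?_, ?_, ?_⟩
    · have := hS0.cj y
      rwa [cj_normal _ π.ker] at this
    · rw [← cj_centralizer, mem_cj]
      have := hQ.1 hxQ
      simpa [mul_assoc] using this
    · rw [← hy, mem_cj]
      simpa [mul_assoc] using hQP0 hxQ
    · intro h
      apply hx
      have := (MonoidHom.normal_ker π).conj_mem _ h y⁻¹
      simpa [mul_assoc] using this
  have hPc : Nat.card P = p ^ 2 := by rw [hP.2, hvtop]
  have hPcomm : ∀ a ∈ P, ∀ b ∈ P, a * b = b * a := by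
    intro a ha b hb
    have := (IsPGroup.commGroupOfCardEqPrimeSq hPc).mul_comm ⟨a, ha⟩ ⟨b, hb⟩
    exact congrArg (fun z : P => (z : X)) this
  have hPker : P ⊓ π.ker = R := by
    symm
    apply Subgroup.eq_of_le_of_card_ge (le_inf hRP hR.1)
    obtain ⟨i, hi⟩ := IsPGroup.iff_card.1 ((IsPGroup.of_card hP.2).to_le (inf_le_left : P ⊓ π.ker ≤ P))
    have := card_pgroup_le hp hi (inf_le_right : P ⊓ π.ker ≤ π.ker)
    rw [hi, hR.2]
    exact Nat.pow_le_pow_right hp.pos this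
  have hPmap : Nat.card (P.map π) = p := by
    have := card_map' π P
    rw [hPc, hPker, hRc, sq] at this
    exact (Nat.eq_of_mul_eq_mul_right hp.pos this).symm
  have hdec : ∀ d ∈ P, ∃ j : ℤ, d * (x ^ j)⁻¹ ∈ R := by
    intro d hd
    have h1 : P.map π ≤ Subgroup.zpowers (π x) :=
      prime_le hp hPmap ⟨x, hxP, rfl⟩ hxT (Subgroup.mem_zpowers _)
    obtain ⟨j, hj⟩ := Subgroup.mem_zpowers_iff.1 (h1 ⟨d, hd, rfl⟩)
    refine ⟨j, ?_⟩
    rw [← hPker]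
    refine ⟨P.mul_mem hd (P.inv_mem (P.zpow_mem hxP j)), ?_⟩
    change π _ = 1
    rw [map_mul, map_inv, map_zpow, hj, mul_inv_cancel]
  have hRF := R_inf_comm π hp hvA hvT.le hR hF
  have hF' := fact_F' π hA hp hvA hvT.le hR hF
  have hcl1 := fun (S : Subgroup X) => claim1 π hA hp hvA hvT.le hR hF hD (S := S)
  set F := Subgroup.centralizer (R : Set X) with hFd
  have hPF : P ≤ F := by
    intro a ha
    rw [hFd, Subgroup.mem_centralizer_iff]
    intro b hb
    exact hPcomm b (hRP hb) a ha
  have hPF' : SylIn p P F := hP.of_le hp le_top hPF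
  obtain ⟨D', hD', hDD'⟩ := syl_exists_ge hp hD.2 (hD.1.trans (Subgroup.commutator_le_self F))
  obtain ⟨y, hy, hyP⟩ := syl_conj hp hD' hPF'
  have hD0P : cj y D ≤ P := hyP ▸ cj_mono y hDD'
  have hD0F : cj y D ≤ ⁅F, F⁆ := by
    have := cj_mono y hD.1
    rwa [cj_commutator, cj_self hy] at this
  have hD0c : Nat.card (cj y D) = p := by rw [card_cj, hD.2, hF', pow_one]
  obtain ⟨d0, hd0, hd1⟩ : ∃ d0 ∈ cj y D, d0 ≠ 1 := by
    have : Nontrivial (cj y D) := by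
      rw [← Finite.one_lt_card_iff_nontrivial, hD0c]; exact hp.one_lt
    obtain ⟨a, ha⟩ := exists_ne (1 : cj y D)
    exact ⟨a, a.2, fun h => ha (Subtype.ext h)⟩
  obtain ⟨j, hj⟩ := hdec d0 (hD0P hd0)
  by_cases hr : d0 * (x ^ j)⁻¹ = 1
  · refine ⟨S, y, hS, prime_le hp hD0c hd0 hd1 ?_⟩
    rw [mul_inv_eq_one.1 hr]
    exact Subgroup.zpow_mem _ hxS j
  · let K : Subgroup X := π.ker ⊓ Subgroup.centralizer {x}
    have hRK : R ≤ K := by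
      refine le_inf hR.1 ?_
      intro a ha
      rw [Subgroup.mem_centralizer_singleton_iff]
      exact hPcomm _ (hRP ha) _ hxP
    have hSK : S ≤ K := by
      refine le_inf hS.1 ?_
      intro a ha
      rw [Subgroup.mem_centralizer_singleton_iff]
      exact (Subgroup.mem_centralizer_iff.1 hxS) a ha
    have key : ∀ k ∈ K, k ∈ Subgroup.normalizer (R : Set X) → k ∈ F := by
      intro k hk hkR
      rw [← cj_eq_iff_normalizer] at hkR
      have hkF : cj k ⁅F, F⁆ = ⁅F, F⁆ := by
        rw [cj_commutator, hFd, cj_centralizer, hkR]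
      have hkx : k * x = x * k := (Subgroup.mem_centralizer_singleton_iff).1 hk.2
      set r := d0 * (x ^ j)⁻¹ with hrd
      have hkxj : k * (x ^ j)⁻¹ * k⁻¹ = (x ^ j)⁻¹ := by
        have : Commute k x := hkx
        have h2 : Commute k (x ^ j)⁻¹ := (this.zpow_right j).inv_right
        rw [h2.eq]; group
      have h1 : k * r * k⁻¹ * r⁻¹ ∈ ⁅F, F⁆ := by
        have h2 : k * r * k⁻¹ * r⁻¹ = (k * d0 * k⁻¹) * d0⁻¹ := by
          have : k * r * k⁻¹ = (k * d0 * k⁻¹) * (x ^ j)⁻¹ := by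
            rw [← hkxj, hrd]; group
          rw [this, hrd]; group
        rw [h2]
        refine Subgroup.mul_mem _ ?_ (Subgroup.inv_mem _ (hD0F hd0))
        rw [← hkF, mem_cj]
        simpa [mul_assoc] using hD0F hd0
      have h2 : k * r * k⁻¹ ∈ R := by
        rw [← hkR, mem_cj]; simpa [mul_assoc] using hj
      have h3 := hRF _ (R.mul_mem h2 (R.inv_mem hj)) h1
      have h4 : k * r = r * k := by
        have := mul_inv_eq_one.1 h3
        rw [← mul_inv_eq_iff_eq_mul]; exact this
      have h5 : R ≤ Subgroup.centralizer {k} :=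
        prime_le hp hRc hj hr (Subgroup.mem_centralizer_singleton_iff.2 h4.symm)
      rw [hFd, Subgroup.mem_centralizer_iff]
      intro a ha
      exact (Subgroup.mem_centralizer_singleton_iff.1 (h5 ha))
    have hvK : (Nat.card K).factorization p = 1 := by
      have h1 : (Nat.card K).factorization p ≤ _ := fact_le_of_le (inf_le_left : K ≤ π.ker) p
      have h2 := card_pgroup_le (k := 1) hp (by rw [hRc, pow_one]) hRK
      omega
    obtain ⟨R1, hR1, hR1S⟩ := burn (K := K) hp hq (Ne.symm hqp) (R := R.subgroupOf K) (S := S.subgroupOf K) hvK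
      (by rw [← hRc]; exact Nat.card_congr (Subgroup.subgroupOfEquivOfLe hRK).toEquiv)
      (by
        intro k hk
        rw [← Subgroup.subgroupOf_normalizer_eq hRK] at hk
        have h1 := key k.1 k.2 hk
        rw [Subgroup.mem_centralizer_iff]
        intro a ha
        exact Subtype.ext ((Subgroup.mem_centralizer_iff.1 h1) a ha))
      (by
        refine ⟨le_top, ?_⟩
        have h1 := (hS.of_le hq (inf_le_left : K ≤ π.ker) hSK).2
        rw [Subgroup.card_top, ← h1]
        exact Nat.card_congr (Subgroup.subgroupOfEquivOfLe hSK).toEquiv)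
    have hR1' : SylIn p (R1.map K.subtype) π.ker := by
      refine ⟨(Subgroup.map_subtype_le R1).trans inf_le_left, ?_⟩
      rw [hvT, pow_one, ← hR1]
      exact (Nat.card_congr (Subgroup.equivMapOfInjective _ _ K.subtype_injective).toEquiv).symm
    have hR1S' : R1.map K.subtype ≤ Subgroup.normalizer (S : Set X) := by
      rintro _ ⟨k, hk, rfl⟩
      have := hR1S hk
      rw [← Subgroup.subgroupOf_normalizer_eq hSK] at this
      exact this
    obtain ⟨t, ht, htR⟩ := syl_conj hp hR1' hR
    have hS' : SylIn q (cj t S) π.ker := by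
      have := hS.cj t
      rwa [cj_normal _ π.ker] at this
    obtain ⟨z, hz⟩ := hcl1 (cj t S) (hB _ hS') (by
      intro a ha
      rw [← htR, mem_cj] at ha
      have := hR1S' ha
      rw [← cj_eq_iff_normalizer] at this ⊢
      rw [cj_mul]
      have h2 : a * t = t * (t⁻¹ * a * t) := by group
      rw [h2, ← cj_mul, this])
    exact ⟨cj t S, z, hS', hz⟩
end cov5


section cov6
variable {X A : Type*} [Group X] [Group A]

lemma bertrand_n (n : ℕ) (hn : 5 ≤ n) : ∃ p : ℕ, p.Prime ∧ p ≠ 2 ∧ p ≤ n ∧ n < 2 * p ∧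
    n.factorial.factorization p = 1 := by
  obtain ⟨p, hp, h1, h2⟩ := Nat.exists_prime_lt_and_le_two_mul (n / 2) (by omega)
  have : Fact p.Prime := ⟨hp⟩
  refine ⟨p, hp, by omega, by omega, by omega, ?_⟩
  have h3 : n / p = 1 := by
    apply Nat.div_eq_of_lt_le <;> omega
  rw [Nat.factorization_def _ hp, ← padicValNat_mul_div_factorial, h3, padicValNat_factorial_mul]
  simp

theorem thmO [Finite X] [IsSimpleGroup A] (hA : commutator A = ⊤) (n : ℕ) (hn : 5 ≤ n)
    (hcA : 2 * Nat.card A = n.factorial) (π : X →* A) (hπ : Function.Surjective π)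
    (hT : Nat.card π.ker ∣ n.factorial) (hTs : IsSimpleGroup π.ker)
    (hTna : ¬ ∀ a b : π.ker, a * b = b * a) : Cov π (Subgroup.centralizer (π.ker : Set X)) := by
  have hB := fun q hq hq2 S => cov_centralizer hA n hn hcA π hπ hT (q := q) hq hq2 (S := S)
  obtain ⟨p, hp, hp2, hpn, hnp, hv⟩ := bertrand_n n hn
  have hvA : (Nat.card A).factorization p = 1 := by
    have hA0 : Nat.card A ≠ 0 := by
      intro h; rw [h] at hcA; have := Nat.factorial_ne_zero n; omega
    rw [← hv, ← hcA, Nat.factorization_mul (by norm_num) hA0,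
        Finsupp.add_apply, Nat.prime_two.factorization, Finsupp.single_eq_of_ne hp2, zero_add]
  have hvT : (Nat.card π.ker).factorization p ≤ 1 := by
    rw [← hv]
    exact (Nat.factorization_le_iff_dvd Nat.card_pos.ne' (Nat.factorial_ne_zero _)).2 hT p
  obtain ⟨R, hR⟩ := syl_exists hp π.ker
  have hF := hB p hp hp2 R hR
  have hF' := fact_F' π hA hp hvA hvT hR hF
  have hFcov := cov_comm π hA hF
  obtain ⟨D, hD⟩ := syl_exists hp ⁅Subgroup.centralizer (R : Set X), Subgroup.centralizer (R : Set X)⁆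
  have hDc : Nat.card D = p := by rw [hD.2, hF', pow_one]
  obtain ⟨d, hd, hd1⟩ : ∃ d ∈ D, d ≠ 1 := by
    have : Nontrivial D := by
      rw [← Finite.one_lt_card_iff_nontrivial, hDc]; exact hp.one_lt
    obtain ⟨a, ha⟩ := exists_ne (1 : D)
    exact ⟨a, a.2, fun h => ha (Subtype.ext h)⟩
  have hdT : d ∉ π.ker := by
    intro h
    have h1 : D ≤ π.ker := prime_le hp hDc hd hd1 h
    have h2 := card_pgroup_le (k := 1) hp (by rw [hDc, pow_one]) (le_inf hD.1 h1)
    have h3 := fact_cov π hFcov p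
    omega
  have hgood : ∀ q : ℕ, q.Prime → q ≠ 2 → ∃ S, SylIn q S π.ker ∧ D ≤ Subgroup.centralizer (S : Set X) := by
    intro q hq hq2
    by_cases hqp : q = p
    · subst hqp
      exact ⟨R, hR, hD.1.trans (Subgroup.commutator_le_self _)⟩
    · obtain ⟨S, y, hS, hy⟩ : ∃ (S : Subgroup X) (y : X), SylIn q S π.ker ∧
          cj y D ≤ Subgroup.centralizer (S : Set X) := by
        rcases (by omega : (Nat.card π.ker).factorization p = 0 ∨
          (Nat.card π.ker).factorization p = 1) with h | h
        · obtain ⟨S, hS⟩ := syl_exists hq π.ker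
          have hRb : R = ⊥ := by
            rw [← Subgroup.card_eq_one, hR.2, h, pow_zero]
          obtain ⟨y, hy⟩ := claim1 π hA hp hvA hvT hR hF hD (hB q hq hq2 S hS) (by rw [hRb]; exact bot_le)
          exact ⟨S, y, hS, hy⟩
        · exact claim2 π hπ hA hp hvA h hR hF hD hq hqp (hB q hq hq2)
      refine ⟨cj y⁻¹ S, ?_, ?_⟩
      · have := hS.cj y⁻¹
        rwa [cj_normal _ π.ker] at this
      · have := cj_mono y⁻¹ hy
        rwa [cj_mul, inv_mul_cancel, cj_one, cj_centralizer] at this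
  have hdel : (MulAut.conjNormal d : MulAut π.ker) = 1 := by
    let FT : Subgroup π.ker := (Subgroup.centralizer {d}).subgroupOf π.ker
    obtain ⟨a, ha⟩ : ∃ a, FT.index = 2 ^ a := by
      rcases Nat.eq_two_pow_or_exists_odd_prime_and_dvd FT.index with h | ⟨q, hq, hqd, hodd⟩
      · exact h
      exfalso
      have hq2 : q ≠ 2 := by rintro rfl; revert hodd; decide
      obtain ⟨S, hS, hDS⟩ := hgood q hq hq2
      have h1 : S.subgroupOf π.ker ≤ FT := by
        intro s hs
        rw [Subgroup.mem_subgroupOf] at hs ⊢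
        rw [Subgroup.mem_centralizer_singleton_iff]
        exact (Subgroup.mem_centralizer_iff.1 (hDS hd)) _ hs
      have h2 := Subgroup.card_dvd_of_le h1
      rw [Nat.card_congr (Subgroup.subgroupOfEquivOfLe hS.1).toEquiv, hS.2] at h2
      have h3 := Nat.mul_dvd_mul h2 hqd
      rw [Subgroup.card_mul_index, ← pow_succ, hq.pow_dvd_iff_le_factorization Nat.card_pos.ne'] at h3
      omega
    refine kazarin hTna _ FT ?_ a ha
    intro t
    rw [Subgroup.mem_subgroupOf, Subgroup.mem_centralizer_singleton_iff, Subtype.ext_iff,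
      MulAut.conjNormal_apply, mul_inv_eq_iff_eq_mul]
    exact eq_comm
  have hnorm : ∀ x ∈ (⊤ : Subgroup X), ∀ k ∈ Subgroup.centralizer (π.ker : Set X),
      x * k * x⁻¹ ∈ Subgroup.centralizer (π.ker : Set X) := by
    intro x _ k hk
    exact centralizer_normalized _ x (by rw [← cj_eq_iff_normalizer, cj_normal]) k hk
  rcases cov_or π (cov_top π hπ) hnorm with h | h
  · exact h
  · exfalso
    apply hdT
    apply h
    rw [Subgroup.mem_centralizer_iff]
    intro t ht
    have h1 := congrArg (fun e : MulAut π.ker => ((e ⟨t, ht⟩ : π.ker) : X)) hdel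
    simp only [MulAut.conjNormal_apply, MulAut.one_apply] at h1
    rw [mul_inv_eq_iff_eq_mul] at h1
    exact h1.symm

/-- inner automorphisms -/
theorem inner_of_action {T : Type*} [Group T] [Finite T] [IsSimpleGroup T]
    (hTna : ¬ ∀ a b : T, a * b = b * a) [Finite A] [IsSimpleGroup A] (hA : commutator A = ⊤) (n : ℕ)
    (hn : 5 ≤ n) (hcA : 2 * Nat.card A = n.factorial) (hT : Nat.card T ∣ n.factorial)
    (φ : A →* MulAut T) : ∀ a, ∃ t : T, φ a = MulAut.conj t := by
  have hfin : Finite (T ⋊[φ] A) := Finite.of_equiv _ (SemidirectProduct.equivProd (φ := φ)).symm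
  let π : T ⋊[φ] A →* A := SemidirectProduct.rightHom
  have hker : π.ker = (SemidirectProduct.inl : T →* T ⋊[φ] A).range := SemidirectProduct.range_inl_eq_ker_rightHom.symm
  let e : T ≃* π.ker := (MonoidHom.ofInjective (SemidirectProduct.inl_injective (φ := φ))).trans
    (MulEquiv.subgroupCongr hker.symm)
  have hs : IsSimpleGroup π.ker := e.symm.isSimpleGroup
  have hcov := thmO hA n hn hcA π SemidirectProduct.rightHom_surjective
    (by rwa [← Nat.card_congr e.toEquiv]) hs (by
      intro h
      apply hTna
      intro a b
      apply e.injective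
      rw [map_mul, map_mul, h])
  intro a
  obtain ⟨x, hx, hxa⟩ := hcov a
  refine ⟨x.left⁻¹, ?_⟩
  have hxa' : x.right = a := hxa
  subst hxa'
  ext t
  have h1 := (Subgroup.mem_centralizer_iff.1 hx) (SemidirectProduct.inl t) (by
    rw [hker]; exact ⟨t, rfl⟩)
  have h2 := congrArg SemidirectProduct.left h1
  simp only [SemidirectProduct.mul_left, SemidirectProduct.left_inl, SemidirectProduct.right_inl,
    map_one, MulAut.one_apply] at h2
  rw [MulAut.conj_apply, inv_inv, mul_assoc, h2]
  simp
end cov6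


section maxn
variable {N : Type*} [Group N]

def MaxN (M : Subgroup N) : Prop :=
  M.Normal ∧ M ≠ ⊤ ∧ ∀ K : Subgroup N, K.Normal → M ≤ K → K = M ∨ K = ⊤

lemma maxN_exists [Finite N] [Nontrivial N] : ∃ M : Subgroup N, MaxN M := by
  have hfin : Set.Finite {K : Subgroup N | K.Normal ∧ K ≠ ⊤} := Set.toFinite _
  obtain ⟨M, hM⟩ := hfin.exists_maximal ⟨⊥, inferInstance, bot_ne_top⟩
  refine ⟨M, hM.prop.1, hM.prop.2, fun K hK hMK => ?_⟩
  by_cases h : K = ⊤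
  · exact Or.inr h
  · left; exact le_antisymm (hM.le_of_ge ⟨hK, h⟩ hMK) hMK

lemma MaxN.simple {M : Subgroup N} (h : MaxN M) [M.Normal] : IsSimpleGroup (N ⧸ M) := by
  have hnt : Nontrivial (N ⧸ M) := by
    rw [QuotientGroup.nontrivial_iff]; exact h.2.1
  refine ⟨fun K hK => ?_⟩
  have hle : M ≤ K.comap (QuotientGroup.mk' M) := by
    intro x hx
    have : QuotientGroup.mk' M x = 1 := (QuotientGroup.eq_one_iff x).2 hx
    rw [Subgroup.mem_comap, this]; exact one_mem K
  have hmap : (K.comap (QuotientGroup.mk' M)).map (QuotientGroup.mk' M) = K :=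
    Subgroup.map_comap_eq_self_of_surjective (QuotientGroup.mk'_surjective M) K
  rcases h.2.2 (K.comap (QuotientGroup.mk' M)) (hK.comap _) hle with h1 | h1
  · left
    rw [← hmap, h1, Subgroup.map_eq_bot_iff, QuotientGroup.ker_mk']
  · right
    rw [← hmap, h1, ← MonoidHom.range_eq_map, MonoidHom.range_eq_top]
    exact QuotientGroup.mk'_surjective M

lemma quot_perfect (hN : commutator N = ⊤) (M : Subgroup N) [M.Normal] : commutator (N ⧸ M) = ⊤ := by
  have h := Subgroup.map_commutator (⊤ : Subgroup N) ⊤ (QuotientGroup.mk' M)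
  have ht : (⊤ : Subgroup N).map (QuotientGroup.mk' M) = ⊤ := by
    rw [← MonoidHom.range_eq_map, MonoidHom.range_eq_top]
    exact QuotientGroup.mk'_surjective M
  rw [ht] at h
  rw [commutator_def, ← h, ← commutator_def, hN, ht]

lemma nonab_of_perfect {T : Type*} [Group T] [Nontrivial T] (hT : commutator T = ⊤) :
    ¬ ∀ a b : T, a * b = b * a := by
  intro h
  have : commutator T = ⊥ := by
    rw [commutator_def, Subgroup.commutator_eq_bot_iff_le_centralizer]
    intro a _
    rw [Subgroup.mem_centralizer_iff]
    intro b _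
    exact h b a
  rw [hT] at this
  exact bot_ne_top this.symm

lemma MaxN.prime (hN : commutator N = ⊤) {M K₁ K₂ : Subgroup N} (h : MaxN M) (h1 : K₁.Normal)
    (h2 : K₂.Normal) (hle : K₁ ⊓ K₂ ≤ M) : K₁ ≤ M ∨ K₂ ≤ M := by
  have := h.1
  by_contra hcon
  push Not at hcon
  have hsup : ∀ K : Subgroup N, K.Normal → ¬ K ≤ M → K.map (QuotientGroup.mk' M) = ⊤ := by
    intro K hK hKM
    have hs := h.simple
    have hn : (K.map (QuotientGroup.mk' M)).Normal := hK.map _ (QuotientGroup.mk'_surjective M)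
    rcases hn.eq_bot_or_eq_top with h3 | h3
    · exfalso; apply hKM
      rwa [Subgroup.map_eq_bot_iff, QuotientGroup.ker_mk'] at h3
    · exact h3
  have e := Subgroup.map_commutator K₁ K₂ (QuotientGroup.mk' M)
  rw [hsup K₁ h1 hcon.1, hsup K₂ h2 hcon.2, ← commutator_def, quot_perfect hN M] at e
  have hb : Subgroup.map (QuotientGroup.mk' M) ⁅K₁, K₂⁆ = ⊥ := by
    rw [Subgroup.map_eq_bot_iff, QuotientGroup.ker_mk']
    exact (Subgroup.commutator_le_inf K₁ K₂).trans hle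
  rw [hb] at e
  have hs := h.simple
  exact bot_ne_top e

lemma inf_maxN_index [Finite N] (hN : commutator N = ⊤) (D : ℕ) (s : Finset (Subgroup N))
    (hs : ∀ M ∈ s, MaxN M ∧ M.index = D) :
    (s.inf id).Normal ∧ (s.inf id).index = D ^ s.card ∧ ∀ M', MaxN M' → s.inf id ≤ M' → M' ∈ s := by
  classical
  induction s using Finset.induction_on with
  | empty =>
    refine ⟨?_, ?_, ?_⟩
    · rw [Finset.inf_empty]; infer_instance
    · simp
    · intro M' h h2
      rw [Finset.inf_empty, top_le_iff] at h2
      exact absurd h2 h.2.1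
  | insert M s hM ih =>
    obtain ⟨i1, i2, i3⟩ := ih (fun K hK => hs K (Finset.mem_insert_of_mem hK))
    obtain ⟨hMm, hMi⟩ := hs M (Finset.mem_insert_self _ _)
    have := hMm.1
    rw [Finset.inf_insert, id, Finset.card_insert_of_notMem hM]
    have hsup : s.inf id ⊔ M = ⊤ := by
      rcases hMm.2.2 (s.inf id ⊔ M) inferInstance le_sup_right with h | h
      · exact absurd (i3 M hMm (h ▸ le_sup_left)) hM
      · exact h
    refine ⟨inferInstance, ?_, ?_⟩
    · rw [← Subgroup.relIndex_mul_index (inf_le_right : M ⊓ s.inf id ≤ s.inf id),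
        Subgroup.inf_relIndex_right, i2, pow_succ, mul_comm]
      congr 1
      rw [← hMi, ← Subgroup.relIndex_top_right, ← hsup, Subgroup.relIndex_sup_right]
    · intro M' hM' hle
      rcases hM'.prime hN hMm.1 i1 hle with h | h
      · rcases hMm.2.2 M' hM'.1 h with h3 | h3
        · rw [h3]; exact Finset.mem_insert_self _ _
        · exact absurd h3 hM'.2.1
      · exact Finset.mem_insert_of_mem (i3 M' hM' h)

lemma index_ge {A : Type*} [Group A] [Finite A] [IsSimpleGroup A] (n : ℕ) (hn : 5 ≤ n)
    (hcA : 2 * Nat.card A = n.factorial) (H : Subgroup A) (hH : H ≠ ⊤) : n ≤ H.index := by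
  by_contra hlt
  push Not at hlt
  have hc : H.normalCore = ⊥ := by
    rcases (Subgroup.normalCore_normal H).eq_bot_or_eq_top with h | h
    · exact h
    · exact absurd (top_le_iff.1 (h ▸ H.normalCore_le)) hH
  rw [Subgroup.normalCore_eq_ker, MonoidHom.ker_eq_bot_iff] at hc
  have h1 := Nat.card_le_card_of_injective _ hc
  rw [Nat.card_perm] at h1
  have h2 : (Nat.card (A ⧸ H)).factorial ≤ (n - 1).factorial := Nat.factorial_le (by
    have : Nat.card (A ⧸ H) = H.index := rfl
    omega)
  have h3 := Nat.mul_factorial_pred (show n ≠ 0 by omega)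
  have h4 := Nat.factorial_pos (n - 1)
  have h5 : 5 * (n - 1).factorial ≤ n * (n - 1).factorial := Nat.mul_le_mul_right _ hn
  omega

theorem maxN_stable [Finite N] (hN : commutator N = ⊤) {A : Type*} [Group A] [Finite A]
    [IsSimpleGroup A] (n : ℕ) (hn : 5 ≤ n) (hcA : 2 * Nat.card A = n.factorial)
    (hcard : Nat.card N = n.factorial) (φ : A →* MulAut N) (M : Subgroup N) (hM : MaxN M) (a : A) :
    M.map (φ a).toMonoidHom = M := by
  have hact : ∀ a b, M.map (φ (a * b)).toMonoidHom = (M.map (φ b).toMonoidHom).map (φ a).toMonoidHom := by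
    intro a b
    rw [Subgroup.map_map, map_mul]; rfl
  have hmaps : ∀ (α : MulAut N) (K : Subgroup N), (K.map α.toMonoidHom).map (α⁻¹).toMonoidHom = K := by
    intro α K
    rw [Subgroup.map_map]
    have : (α⁻¹).toMonoidHom.comp α.toMonoidHom = MonoidHom.id N := by
      ext x; exact MulAut.inv_apply_self _ α x
    rw [this, Subgroup.map_id]
  have hmax : ∀ α : MulAut N, MaxN (M.map α.toMonoidHom) := by
    intro α
    refine ⟨hM.1.map _ α.surjective, ?_, ?_⟩
    · intro h
      apply hM.2.1
      have := hmaps α M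
      rw [h] at this
      rw [← this, ← MonoidHom.range_eq_map, MonoidHom.range_eq_top]
      exact (α⁻¹).surjective
    · intro K hK hle
      have h1 : M ≤ K.map (α⁻¹).toMonoidHom := by
        have := Subgroup.map_mono (f := (α⁻¹).toMonoidHom) hle
        rwa [hmaps] at this
      have h2 := hmaps α⁻¹ K
      rw [inv_inv] at h2
      rcases hM.2.2 _ (hK.map _ (α⁻¹).surjective) h1 with h | h
      · left; rw [← h, h2]
      · right; rw [← h2, h, ← MonoidHom.range_eq_map, MonoidHom.range_eq_top]
        exact α.surjective
  let H : Subgroup A :=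
    { carrier := {a | M.map (φ a).toMonoidHom = M}
      one_mem' := by
        change M.map (φ 1).toMonoidHom = M
        rw [map_one]; exact Subgroup.map_id M
      mul_mem' := by
        intro a b ha hb
        change M.map (φ (a * b)).toMonoidHom = M
        rw [hact, hb, ha]
      inv_mem' := by
        intro a ha
        change M.map (φ a⁻¹).toMonoidHom = M
        have := hmaps (φ a) M
        rwa [show M.map (φ a).toMonoidHom = M from ha, ← map_inv] at this }
  by_cases hH : H = ⊤
  · have : a ∈ H := hH ▸ Subgroup.mem_top a
    exact this
  exfalso
  have hge := index_ge n hn hcA H hH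
  have hrange := card_range_eq_index H (fun a => M.map (φ a).toMonoidHom) (by
    intro s t
    change _ ↔ M.map (φ (s⁻¹ * t)).toMonoidHom = M
    rw [hact]
    constructor
    · intro h
      rw [← show M.map (φ s).toMonoidHom = M.map (φ t).toMonoidHom from h, map_inv]
      exact hmaps _ _
    · intro h
      have h2 := hmaps (φ s)⁻¹ (M.map (φ t).toMonoidHom)
      rw [map_inv] at h
      rw [h, inv_inv] at h2
      exact h2)
  set O := Set.range (fun a => M.map (φ a).toMonoidHom) with hO
  have hOf : O.Finite := Set.toFinite _
  obtain ⟨_, h1, _⟩ := inf_maxN_index hN M.index hOf.toFinset (by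
    intro K hK
    obtain ⟨a, rfl⟩ := hOf.mem_toFinset.1 hK
    refine ⟨hmax _, ?_⟩
    exact Subgroup.index_map_equiv M (φ a))
  have hcO : hOf.toFinset.card = H.index := by
    rw [← hrange, ← Set.ncard_eq_toFinset_card O hOf]; rfl
  have hdv : M.index ^ H.index ∣ n.factorial := by
    rw [← hcard, ← hcO, ← h1]
    exact Subgroup.index_dvd_card _
  have hMi : M.index ≠ 1 := fun h => hM.2.1 (Subgroup.index_eq_one.1 h)
  obtain ⟨q, hq, hqd⟩ := Nat.exists_prime_and_dvd hMi
  have hqf : Fact q.Prime := ⟨hq⟩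
  have h5 : q ^ H.index ∣ n.factorial := (pow_dvd_pow_of_dvd hqd _).trans hdv
  rw [padicValNat_dvd_iff_le (Nat.factorial_ne_zero _)] at h5
  have h6 := nt_legendre q n H.index hq (by omega) h5
  have h7 : 1 * H.index ≤ (q - 1) * H.index := Nat.mul_le_mul_right _ (by have := hq.two_le; omega)
  omega

/-- induced action on a quotient -/
def quotAct {G : Type*} [Group G] (φ : G →* MulAut N) (M : Subgroup N) [M.Normal]
    (h : ∀ a, M.map (φ a).toMonoidHom = M) : G →* MulAut (N ⧸ M) where
  toFun a := QuotientGroup.congr M M (φ a) (h a)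
  map_one' := by
    ext x
    induction x using QuotientGroup.induction_on with
    | H x => simp
  map_mul' a b := by
    ext x
    induction x using QuotientGroup.induction_on with
    | H x =>
      change ((φ (a * b) x : N) : N ⧸ M) = ((φ a (φ b x) : N) : N ⧸ M)
      rw [map_mul]; rfl

lemma quotAct_mk {G : Type*} [Group G] (φ : G →* MulAut N) (M : Subgroup N) [M.Normal]
    (h : ∀ a, M.map (φ a).toMonoidHom = M) (a : G) (x : N) :
    quotAct φ M h a (x : N ⧸ M) = ((φ a x : N) : N ⧸ M) := rfl
end maxn


section comb
open Equiv.Perm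

lemma cyc_type {n p : ℕ} (hp : p.Prime) (hnp : n < 2 * p) {s : Equiv.Perm (Fin n)}
    (hs : orderOf s = p) : s.cycleType = {p} := by
  have h : s.IsCycle := isCycle_of_prime_order' (by rw [hs]; exact hp)
    (by rw [hs, Fintype.card_fin]; exact hnp)
  rw [h.cycleType, ← hs, h.orderOf]

lemma sign_odd_order {n p : ℕ} (hp : p.Prime) (hp2 : p ≠ 2) {s : Equiv.Perm (Fin n)}
    (hs : orderOf s = p) : s ∈ alternatingGroup (Fin n) := by
  rw [mem_alternatingGroup]
  have h1 : (sign s) ^ p = 1 := by rw [← map_pow, ← hs, pow_orderOf_eq_one, map_one]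
  rcases Int.units_eq_one_or (sign s) with h | h
  · exact h
  · rw [h, (hp.odd_of_ne_two hp2).neg_one_pow] at h1
    exact absurd h1 (by decide)

lemma alt_or {n : ℕ} {c t : Equiv.Perm (Fin n)} (ht : sign t = -1) :
    c ∈ alternatingGroup (Fin n) ∨ c * t ∈ alternatingGroup (Fin n) := by
  rw [mem_alternatingGroup, mem_alternatingGroup, map_mul, ht]
  rcases Int.units_eq_one_or (sign c) with h | h
  · exact Or.inl h
  · right; rw [h]; decide

theorem comb_main (n : ℕ) (hn : 5 ≤ n) (β : Equiv.Perm (Fin n) →* Equiv.Perm (Fin n))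
    (hinj : ∀ s ∈ alternatingGroup (Fin n), β s = 1 → s = 1)
    (hkey : ∀ m c, c ∈ alternatingGroup (Fin n) → β m = c * m * c⁻¹ → m ^ 2 = 1) : False := by
  obtain ⟨p, hp, hp2, hpn, hnp, hv⟩ := bertrand_n n hn
  have hpf : Fact p.Prime := ⟨hp⟩
  obtain ⟨y, hy⟩ := exists_prime_orderOf_dvd_card' (G := Equiv.Perm (Fin n)) p (by
    rw [Nat.card_perm, Nat.card_fin]; exact hp.dvd_factorial.2 hpn)
  have hyA := sign_odd_order hp hp2 hy
  have hy1 : y ≠ 1 := by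
    rintro rfl
    rw [orderOf_one] at hy
    exact hp.ne_one hy.symm
  have hby : orderOf (β y) = p := by
    apply orderOf_eq_prime
    · rw [← map_pow, ← hy, pow_orderOf_eq_one, map_one]
    · exact fun h => hy1 (hinj y hyA h)
  have hct := cyc_type hp hnp hy
  have hp3 : 3 ≤ p := by have := hp.two_le; omega
  by_cases hc : p + 2 ≤ n
  · -- room for a transposition
    obtain ⟨c, hcc⟩ := isConj_iff.1 (isConj_of_cycleType_eq (hct.trans (cyc_type hp hnp hby).symm))
    have hsq : y ^ 2 = 1 → False := by
      intro h
      have := orderOf_dvd_of_pow_eq_one h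
      rw [hy] at this
      have := Nat.le_of_dvd (by norm_num) this
      omega
    have hsup : y.support.card = p := by
      rw [← sum_cycleType, hct, Multiset.sum_singleton]
    have : 1 < (y.support)ᶜ.card := by
      rw [Finset.card_compl, hsup, Fintype.card_fin]; omega
    obtain ⟨i, hi, j, hj, hij⟩ := Finset.one_lt_card.1 this
    rw [Finset.mem_compl, notMem_support] at hi hj
    have hcomm : y * Equiv.swap i j = Equiv.swap i j * y := by
      have := Equiv.mul_swap_eq_swap_mul y i j
      rw [hi, hj] at this
      exact this
    rcases alt_or (c := c) (sign_swap hij) with h | h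
    · exact hsq (hkey y c h hcc.symm)
    · refine hsq (hkey y _ h ?_)
      rw [mul_assoc c, ← hcomm, ← hcc]
      group
  · have hp5 : 5 ≤ p := by
      by_contra h
      have : p = 3 ∨ p = 4 := by omega
      rcases this with rfl | rfl
      · omega
      · exact absurd hp (by decide)
    -- centralizer of y
    have hcard : Nat.card (Subgroup.centralizer ({y} : Set (Equiv.Perm (Fin n)))) = p := by
      rw [nat_card_centralizer, hct]
      have : (n - p).factorial = 1 := by
        have : n - p = 0 ∨ n - p = 1 := by omega
        rcases this with h | h <;> simp [h]
      simp [this]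
    have hle : Subgroup.zpowers y ≤ Subgroup.centralizer ({y} : Set (Equiv.Perm (Fin n))) := by
      rw [Subgroup.zpowers_le, Subgroup.mem_centralizer_singleton_iff]
    have hcen : Subgroup.zpowers y = Subgroup.centralizer ({y} : Set (Equiv.Perm (Fin n))) := by
      apply Subgroup.eq_of_le_of_card_ge hle
      rw [hcard, Nat.card_zpowers, hy]
    have hvA : (Nat.card (alternatingGroup (Fin n))).factorization p = 1 := by
      have : Nontrivial (Fin n) := Fin.nontrivial_iff_two_le.2 (by omega)
      have hcA : 2 * Nat.card (alternatingGroup (Fin n)) = n.factorial := by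
        rw [two_mul_nat_card_alternatingGroup, Nat.card_perm, Nat.card_fin]
      have hA0 : Nat.card (alternatingGroup (Fin n)) ≠ 0 := Nat.card_pos.ne'
      rw [← hv, ← hcA, Nat.factorization_mul (by norm_num) hA0,
        Finsupp.add_apply, Nat.prime_two.factorization, Finsupp.single_eq_of_ne hp2, zero_add]
    have hS : ∀ z : Equiv.Perm (Fin n), orderOf z = p →
        SylIn p (Subgroup.zpowers z) (alternatingGroup (Fin n)) := by
      intro z hz
      refine ⟨?_, ?_⟩
      · rw [Subgroup.zpowers_le]; exact sign_odd_order hp hp2 hz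
      · rw [hvA, Nat.card_zpowers, hz, pow_one]
    obtain ⟨a, haA, ha⟩ := syl_conj hp (hS y hy) (hS _ hby)
    have h1 : β y ∈ cj a (Subgroup.zpowers y) := by rw [ha]; exact Subgroup.mem_zpowers _
    rw [mem_cj] at h1
    have h2 : a * y * a⁻¹ ∈ Subgroup.zpowers (β y) := by
      rw [← ha, mem_cj]
      convert Subgroup.mem_zpowers y using 1
      group
    obtain ⟨k, hk⟩ := Subgroup.mem_zpowers_iff.1 h2
    have hy2 : orderOf (y ^ 2) = p := by
      apply orderOf_eq_prime
      · rw [← pow_mul, mul_comm, pow_mul, ← hy, pow_orderOf_eq_one, one_pow]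
      · intro h
        have := orderOf_dvd_of_pow_eq_one h
        rw [hy] at this
        have := Nat.le_of_dvd (by norm_num) this
        omega
    obtain ⟨m, hm⟩ := isConj_iff.1 (isConj_of_cycleType_eq (hct.trans (cyc_type hp hnp hy2).symm))
    have hbm : β m * (a * y * a⁻¹) * (β m)⁻¹ = (a * y * a⁻¹) ^ 2 := by
      rw [← hk, ← map_zpow, ← map_inv, ← map_mul, ← map_mul, ← map_pow, ← conj_zpow, hm]
      congr 1
      rw [← zpow_natCast, ← zpow_natCast, ← zpow_mul, ← zpow_mul, mul_comm]
    set m' := a⁻¹ * β m * a with hm'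
    have hm'y : m' * y * m'⁻¹ = y ^ 2 := by
      have : m' * y * m'⁻¹ = a⁻¹ * (β m * (a * y * a⁻¹) * (β m)⁻¹) * a := by rw [hm']; group
      rw [this, hbm, conj_pow]; group
    have hcz : m⁻¹ * m' ∈ Subgroup.zpowers y := by
      rw [hcen, Subgroup.mem_centralizer_singleton_iff]
      have e1 : m' * y = m * y * m⁻¹ * m' := by rw [hm, ← hm'y]; group
      rw [mul_assoc, e1]; group
    obtain ⟨i, hi⟩ := Subgroup.mem_zpowers_iff.1 hcz
    have hmy : ∀ j : ℤ, m * y ^ j = y ^ (2 * j) * m := by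
      intro j
      have : m * y ^ j * m⁻¹ = y ^ (2 * j) := by
        rw [← conj_zpow, hm, ← zpow_natCast, ← zpow_mul]; rfl
      rw [← this]; group
    have e2 : m' = y ^ (-(2 * i)) * m * (y ^ (-(2 * i)))⁻¹ := by
      have e3 : m' = m * y ^ i := by rw [hi]; group
      have e4 := hmy (2 * i)
      have e5 := hmy i
      rw [← zpow_neg, neg_neg, mul_assoc, e4, e3, e5, ← mul_assoc, ← zpow_add]
      congr 2
      ring
    have e6 : m ^ 2 = 1 := by
      apply hkey m (a * y ^ (-(2 * i)))
      · exact mul_mem haA (zpow_mem hyA _)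
      · have : β m = a * m' * a⁻¹ := by rw [hm']; group
        rw [this, e2]; group
    have e7 : y = y ^ 4 := by
      have h3 : m ^ 2 * y * (m ^ 2)⁻¹ = y ^ 4 := by
        have : m ^ 2 * y * (m ^ 2)⁻¹ = m * (m * y * m⁻¹) * m⁻¹ := by rw [pow_two]; group
        rw [this, hm, ← conj_pow, hm, ← pow_mul]
      rw [e6] at h3
      simpa using h3
    have e8 : y ^ 3 = 1 := by
      have : y * y ^ 3 = y * 1 := by rw [← pow_succ', ← e7, mul_one]
      exact mul_left_cancel this
    have := orderOf_dvd_of_pow_eq_one e8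
    rw [hy] at this
    have := Nat.le_of_dvd (by norm_num) this
    omega
end comb


section fin
lemma perfect_no_index2 {N : Type*} [Group N] (hN : commutator N = ⊤) (H : Subgroup N)
    (hH : H.index = 2) : False := by
  have : H.Normal := Subgroup.normal_of_index_eq_two hH
  have hc : Nat.card (N ⧸ H) = 2 := hH
  have : Nontrivial (N ⧸ H) := by
    have : Finite (N ⧸ H) := Nat.finite_of_card_ne_zero (by omega)
    exact Finite.one_lt_card_iff_nontrivial.1 (by omega)
  have : Fact (Nat.Prime 2) := ⟨Nat.prime_two⟩
  have hcy := isCyclic_of_prime_card hc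
  apply nonab_of_perfect (quot_perfect hN H)
  intro a b
  obtain ⟨z, hz⟩ := hcy.exists_generator
  obtain ⟨i, rfl⟩ := Subgroup.mem_zpowers_iff.1 (hz a)
  obtain ⟨j, rfl⟩ := Subgroup.mem_zpowers_iff.1 (hz b)
  rw [← zpow_add, ← zpow_add, add_comm]

lemma perfect_no_embed {N A : Type*} [Group N] [Group A] [Finite A] (hN : commutator N = ⊤)
    (hc : Nat.card N = 2 * Nat.card A) (W : A →* N) (hW : Function.Injective W) : False := by
  apply perfect_no_index2 hN W.range
  have h1 := W.range.index_mul_card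
  have h2 : Nat.card W.range = Nat.card A := Nat.card_congr (Equiv.ofInjective W hW).symm
  rw [h2, hc] at h1
  exact Nat.eq_of_mul_eq_mul_right Nat.card_pos h1

lemma central_act {N : Type*} [Group N] (hN : commutator N = ⊤) (α : MulAut N)
    (h : ∀ x, α x * x⁻¹ ∈ Subgroup.center N) (x : N) : α x = x := by
  let w : N →* Subgroup.center N := MonoidHom.mk' (fun x => ⟨α x * x⁻¹, h x⟩) (by
    intro a b
    apply Subtype.ext
    change α (a * b) * (a * b)⁻¹ = α a * a⁻¹ * (α b * b⁻¹)
    have := Subgroup.mem_center_iff.1 (h b) a⁻¹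
    rw [mul_assoc (α a), this, map_mul]
    group)
  have h1 : commutator N ≤ w.ker := by
    rw [commutator_def, Subgroup.commutator_le]
    intro a _ b _
    rw [MonoidHom.mem_ker, map_commutatorElement, commutatorElement_eq_one_iff_mul_comm]
    exact Subtype.ext (Subgroup.mem_center_iff.1 (w b).2 (w a))
  rw [hN] at h1
  have h2 : w x = 1 := h1 (Subgroup.mem_top x)
  have h3 : α x * x⁻¹ = 1 := congrArg (fun z : Subgroup.center N => (z : N)) h2
  exact mul_inv_eq_one.1 h3

lemma two_unique {N : Type*} [Group N] {M : Subgroup N} (hM : Nat.card M = 2) {x y : N}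
    (hx : x ∈ M) (hy : y ∈ M) (hx1 : x ≠ 1) (hy1 : y ≠ 1) : x = y := by
  obtain ⟨b, _, hb⟩ := (Nat.card_eq_two_iff' (1 : M)).1 hM
  have h1 := hb ⟨x, hx⟩ (fun h => hx1 (congrArg (fun z : M => (z : N)) h))
  have h2 := hb ⟨y, hy⟩ (fun h => hy1 (congrArg (fun z : M => (z : N)) h))
  exact congrArg (fun z : M => (z : N)) (h1.trans h2.symm)

lemma order2_central {N : Type*} [Group N] {M : Subgroup N} [hn : M.Normal] (hM : Nat.card M = 2) :
    M ≤ Subgroup.center N := by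
  intro m hm
  rw [Subgroup.mem_center_iff]
  intro x
  by_cases h : m = 1
  · simp [h]
  · have := two_unique hM (hn.conj_mem m hm x) hm (by simpa using h) h
    rw [← mul_inv_eq_iff_eq_mul]; exact this

lemma simple_inj_surj {T A : Type*} [Group T] [Finite T] [IsSimpleGroup T] [Group A] [Finite A]
    [Nontrivial A] (h : Nat.card T ∣ 2 * Nat.card A) (W : A →* T) (hW : Function.Injective W) :
    Function.Surjective W := by
  have h1 := W.range.index_mul_card
  have h2 : Nat.card W.range = Nat.card A := Nat.card_congr (Equiv.ofInjective W hW).symm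
  rw [h2] at h1
  have h3 : W.range.index ∣ 2 := by
    rw [← h1] at h
    exact Nat.dvd_of_mul_dvd_mul_right Nat.card_pos h
  rcases (Nat.dvd_prime Nat.prime_two).1 h3 with h4 | h4
  · exact MonoidHom.range_eq_top.1 (Subgroup.index_eq_one.1 h4)
  · have hn : W.range.Normal := Subgroup.normal_of_index_eq_two h4
    rcases hn.eq_bot_or_eq_top with h5 | h5
    · rw [h5, Subgroup.card_bot] at h2
      have := Finite.one_lt_card (α := A)
      omega
    · exact MonoidHom.range_eq_top.1 h5

lemma conj_inj {T : Type*} [Group T] [IsSimpleGroup T] (hna : ¬ ∀ a b : T, a * b = b * a) :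
    Function.Injective (MulAut.conj (G := T)) := by
  rw [injective_iff_map_eq_one]
  intro a ha
  have hac : a ∈ Subgroup.center T := by
    rw [Subgroup.mem_center_iff]
    intro x
    have := DFunLike.congr_fun ha x
    rw [MulAut.conj_apply, MulAut.one_apply] at this
    rw [mul_inv_eq_iff_eq_mul] at this
    exact this.symm
  rcases (inferInstance : (Subgroup.center T).Normal).eq_bot_or_eq_top with h | h
  · rw [h] at hac; exact Subgroup.mem_bot.1 hac
  · exfalso; apply hna
    intro x y
    have : y ∈ Subgroup.center T := by rw [h]; trivial
    exact Subgroup.mem_center_iff.1 this x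

lemma triv_or_inj {T A : Type*} [Group T] [Group A] [IsSimpleGroup A] (W : A →* T) :
    (∀ a, W a = 1) ∨ Function.Injective W := by
  rcases (inferInstance : W.ker.Normal).eq_bot_or_eq_top with h | h
  · right; exact (MonoidHom.ker_eq_bot_iff W).1 h
  · left; intro a
    have : a ∈ W.ker := by rw [h]; trivial
    exact this

lemma mk_eq_imp {N : Type*} [Group N] {M : Subgroup N} [M.Normal] {x y : N}
    (h : (x : N ⧸ M) = (y : N ⧸ M)) : x * y⁻¹ ∈ M := by
  rw [← QuotientGroup.eq_one_iff, QuotientGroup.mk_mul, QuotientGroup.mk_inv, h, mul_inv_cancel]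

/-- the final case -/
theorem final_case (n : ℕ) (hn : 5 ≤ n) {N : Type*} [Group N]
    (f : Equiv.Perm (Fin n) →* MulAut N) (g : Equiv.Perm (Fin n) → N)
    (hg : Function.Bijective g)
    (hfg : ∀ σ τ : Equiv.Perm (Fin n), g (σ * τ) = g σ * f σ (g τ))
    (M : Subgroup N) [M.Normal] (hM2 : Nat.card M = 2)
    (hst : ∀ s, M.map (f s).toMonoidHom = M)
    (hci : Function.Injective (MulAut.conj (G := N ⧸ M)))
    (U : alternatingGroup (Fin n) →* N ⧸ M) (hU : Function.Bijective U)
    (hUf : ∀ s : alternatingGroup (Fin n), quotAct f M hst s = MulAut.conj (U s))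
    (hV : ∀ s : alternatingGroup (Fin n), (g s : N ⧸ M) * U s = 1 → s = 1) : False := by
  have hΦ : ∀ (t : Equiv.Perm (Fin n)) (s : alternatingGroup (Fin n)),
      quotAct f M hst t (U s) = U (MulAut.conjNormal t s) := by
    intro t s
    apply hci
    have h1 : MulAut.conj (quotAct f M hst t (U s)) =
        quotAct f M hst t * MulAut.conj (U s) * (quotAct f M hst t)⁻¹ := by
      ext x
      simp [MulAut.mul_apply, MulAut.conj_apply]
    rw [h1, ← hUf, ← hUf, ← map_inv, ← map_mul, ← map_mul, MulAut.conjNormal_apply]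
  choose a ha using fun t => hU.2 (g t : N ⧸ M)
  have hamul : ∀ s t, a (s * t) = a s * MulAut.conjNormal s (a t) := by
    intro s t
    apply hU.1
    rw [ha, hfg, QuotientGroup.mk_mul, ← quotAct_mk f M hst, ← ha s, ← ha t, hΦ, map_mul]
  let β : Equiv.Perm (Fin n) →* Equiv.Perm (Fin n) :=
    MonoidHom.mk' (fun t => (a t : Equiv.Perm (Fin n)) * t) (by
      intro s t
      rw [hamul, Subgroup.coe_mul, MulAut.conjNormal_apply]
      group)
  have hβ : ∀ t, β t = (a t : Equiv.Perm (Fin n)) * t := fun _ => rfl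
  have hg1 : g 1 = 1 := by
    have := hfg 1 1
    rw [mul_one, map_one, MulAut.one_apply] at this
    exact (mul_eq_left.1 this.symm)
  apply comb_main n hn β
  · intro s hs h
    have h1 : a s * (⟨s, hs⟩ : alternatingGroup (Fin n)) = 1 := Subtype.ext h
    have h2 : (g s : N ⧸ M) * U ⟨s, hs⟩ = 1 := by rw [← ha, ← map_mul, h1, map_one]
    exact congrArg (fun z : alternatingGroup (Fin n) => (z : Equiv.Perm (Fin n))) (hV ⟨s, hs⟩ h2)
  · intro m c hc hm
    obtain ⟨x, hx⟩ := QuotientGroup.mk_surjective (U ⟨c, hc⟩)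
    obtain ⟨t, rfl⟩ := hg.2 x
    have hat : a t = ⟨c, hc⟩ := hU.1 (by rw [ha, hx])
    have hfix : ∀ z, β z = z → g z ∈ M := by
      intro z hz
      rw [hβ, mul_eq_right] at hz
      have : a z = 1 := Subtype.ext hz
      rw [← QuotientGroup.eq_one_iff, ← ha, this, map_one]
    have hz : β (t⁻¹ * m * t) = t⁻¹ * m * t := by
      rw [map_mul, map_mul, map_inv, hm, hβ t, hat]
      change (c * t)⁻¹ * (c * m * c⁻¹) * (c * t) = _
      group
    have hmz : m = t * (t⁻¹ * m * t) * t⁻¹ := by group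
    generalize t⁻¹ * m * t = z at hz hmz
    have hz2 : z ^ 2 = 1 := by
      by_contra hne
      have hz1 : z ≠ 1 := by rintro rfl; simp at hne
      have key : ∀ w, w ≠ 1 → g w ≠ 1 := fun w hw h => hw (hg.1 (h.trans hg1.symm))
      have := two_unique hM2 (hfix z hz) (hfix (z ^ 2) (by rw [map_pow, hz])) (key _ hz1) (key _ hne)
      have := hg.1 this
      rw [pow_two] at this
      exact hz1 (mul_eq_left.1 this.symm)
    rw [hmz, conj_pow, hz2]; group

end fin

theorem stmt_5 (n : ℕ) (hn : 5 ≤ n) (N : Type*) [Group N]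
    (hcard : Nat.card N = n.factorial)
    (f : Equiv.Perm (Fin n) →* MulAut N) (g : Equiv.Perm (Fin n) → N)
    (hg : Function.Bijective g)
    (hfg : ∀ σ τ : Equiv.Perm (Fin n), g (σ * τ) = g σ * f σ (g τ)) :
    commutator N ≠ ⊤ := by
  intro hN
  have hnt : Nontrivial (Fin n) := Fin.nontrivial_iff_two_le.2 (by omega)
  have h5 : 5 ≤ Nat.card (Fin n) := by simpa using hn
  have hfin : Finite N := Nat.finite_of_card_ne_zero (by rw [hcard]; exact Nat.factorial_ne_zero _)
  have hNn : Nontrivial N := by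
    apply Finite.one_lt_card_iff_nontrivial.1
    rw [hcard]
    have := Nat.self_le_factorial n
    omega
  have hAs : IsSimpleGroup (alternatingGroup (Fin n)) := alternatingGroup.isSimpleGroup h5
  have hAp : commutator (alternatingGroup (Fin n)) = ⊤ := commutator_alternatingGroup_eq_top h5
  have hcA : 2 * Nat.card (alternatingGroup (Fin n)) = n.factorial := by
    rw [two_mul_nat_card_alternatingGroup, Nat.card_perm, Nat.card_fin]
  obtain ⟨M, hM⟩ := maxN_exists (N := N)
  have hMn : M.Normal := hM.1
  have hTs : IsSimpleGroup (N ⧸ M) := hM.simple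
  have hTp := quot_perfect hN M
  have hTna := nonab_of_perfect hTp
  have hci := conj_inj hTna
  let φ : alternatingGroup (Fin n) →* MulAut N := f.comp (alternatingGroup (Fin n)).subtype
  have hφst := maxN_stable hN n hn hcA hcard φ M hM
  have hcT : Nat.card (N ⧸ M) * Nat.card M = n.factorial := by
    rw [← hcard]; exact M.index_mul_card
  have hTd : Nat.card (N ⧸ M) ∣ n.factorial := ⟨_, hcT.symm⟩
  have hin := inner_of_action hTna hAp n hn hcA hTd (quotAct φ M hφst)
  choose u hu using hin
  let U : alternatingGroup (Fin n) →* N ⧸ M := MonoidHom.mk' u (by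
    intro s t
    apply hci
    rw [← hu, map_mul, map_mul, hu, hu])
  have hU : ∀ s, quotAct φ M hφst s = MulAut.conj (U s) := hu
  let V : alternatingGroup (Fin n) →* N ⧸ M := MonoidHom.mk' (fun s => (g s : N ⧸ M) * U s) (by
    intro s t
    have h1 : ((f s (g t) : N) : N ⧸ M) = U s * (g t : N ⧸ M) * (U s)⁻¹ := by
      have := quotAct_mk φ M hφst s (g t)
      rw [hU, MulAut.conj_apply] at this
      exact this.symm
    rw [Subgroup.coe_mul, hfg, QuotientGroup.mk_mul, h1, map_mul]
    group)
  have hV : ∀ s, V s = (g s : N ⧸ M) * U s := fun _ => rfl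
  -- not both trivial
  by_cases hboth : (∀ s, U s = 1) ∧ (∀ s, V s = 1)
  · obtain ⟨hU1, hV1⟩ := hboth
    have hmem : ∀ s : alternatingGroup (Fin n), g s ∈ M := by
      intro s
      have := hV1 s
      rw [hV, hU1, mul_one] at this
      exact (QuotientGroup.eq_one_iff _).1 this
    have hle : Nat.card (alternatingGroup (Fin n)) ≤ Nat.card M := by
      apply Nat.card_le_card_of_injective (fun s : alternatingGroup (Fin n) => (⟨g s, hmem s⟩ : M))
      intro s t h
      exact Subtype.ext (hg.1 (congrArg (fun z : M => (z : N)) h))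
    have hA0 : 0 < Nat.card (alternatingGroup (Fin n)) := Nat.card_pos
    have hT2 : Nat.card (N ⧸ M) ≤ 2 := by
      by_contra h
      have : 3 * Nat.card M ≤ Nat.card (N ⧸ M) * Nat.card M := Nat.mul_le_mul_right _ (by omega)
      omega
    have h1 := Finite.one_lt_card (α := N ⧸ M)
    exact perfect_no_index2 hN M (by rw [Subgroup.index]; omega)
  have hcT' : Nat.card (N ⧸ M) ∣ 2 * Nat.card (alternatingGroup (Fin n)) := by rw [hcA]; exact hTd
  have hM2 : Nat.card M = 2 := by
    have : ∃ W : alternatingGroup (Fin n) →* N ⧸ M, Function.Injective W := by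
      rcases triv_or_inj U with h | h
      · rcases triv_or_inj V with h' | h'
        · exact absurd ⟨h, h'⟩ hboth
        · exact ⟨V, h'⟩
      · exact ⟨U, h⟩
    obtain ⟨W, hW⟩ := this
    have h1 := Nat.card_congr (Equiv.ofBijective W ⟨hW, simple_inj_surj hcT' W hW⟩)
    rw [← h1, ← hcA, mul_comm] at hcT
    exact Nat.eq_of_mul_eq_mul_right Nat.card_pos hcT
  have hMc : Subgroup.center N = M := by
    rcases hM.2.2 (Subgroup.center N) inferInstance (order2_central hM2) with h | h
    · exact h
    · exfalso
      apply nonab_of_perfect hN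
      intro x y
      have : y ∈ Subgroup.center N := by rw [h]; trivial
      exact Subgroup.mem_center_iff.1 this x
  have hcN : Nat.card N = 2 * Nat.card (alternatingGroup (Fin n)) := by rw [hcard, hcA]
  rcases triv_or_inj U with hU1 | hUi
  · have hf1 : ∀ (s : alternatingGroup (Fin n)) (x : N), f s x = x := by
      intro s
      apply central_act hN (f s)
      intro x
      rw [hMc]
      apply mk_eq_imp
      have := quotAct_mk φ M hφst s x
      rw [hU, hU1, map_one, MulAut.one_apply] at this
      exact this.symm
    apply perfect_no_embed hN hcN (MonoidHom.mk' (fun s : alternatingGroup (Fin n) => g s) (by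
      intro s t
      rw [Subgroup.coe_mul, hfg, hf1]))
    intro s t h
    exact Subtype.ext (hg.1 h)
  rcases triv_or_inj V with hV1 | hVi
  · have hf1 : ∀ (s : alternatingGroup (Fin n)) (x : N), g s * f s x * (g s)⁻¹ = x := by
      intro s
      apply central_act hN (MulAut.conj (g s) * f s)
      intro x
      rw [hMc]
      apply mk_eq_imp
      have h1 := quotAct_mk φ M hφst s x
      rw [hU, MulAut.conj_apply] at h1
      have h1' : ((f s x : N) : N ⧸ M) = U s * (x : N ⧸ M) * (U s)⁻¹ := h1.symm
      have h2 := hV1 s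
      rw [hV, mul_eq_one_iff_eq_inv] at h2
      rw [MulAut.mul_apply, MulAut.conj_apply, QuotientGroup.mk_mul, QuotientGroup.mk_mul,
        QuotientGroup.mk_inv, h1', h2]
      group
    apply perfect_no_embed hN hcN (MonoidHom.mk' (fun s : alternatingGroup (Fin n) => (g s)⁻¹) (by
      intro s t
      have := hf1 s (g t)
      rw [← mul_inv_rev, Subgroup.coe_mul, hfg]
      rw [mul_inv_eq_iff_eq_mul] at this
      rw [this]))
    intro s t h
    exact Subtype.ext (hg.1 (inv_injective h))
  have hst : ∀ s, M.map (f s).toMonoidHom = M := by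
    intro s
    have h := Subgroup.characteristic_iff_map_eq.1 (inferInstance : (Subgroup.center N).Characteristic) (f s)
    rw [hMc] at h
    exact h
  apply final_case n hn f g hg hfg M hM2 hst hci U ⟨hUi, simple_inj_surj hcT' U hUi⟩
  · intro s
    rw [← hU]
    rfl
  · intro s hs
    exact hVi (by rw [hV, hs, map_one])
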